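/- arXiv:2507.06365 — 2 statements merged into one kernel-verified Lean document; each statement's English description precedes it below -/
import Mathlib

section
/- The Salvetti complex |Sal(A,V)| is homotopy equivalent to the complexified complement M(A). That is, for any finite collection A of cooriented affine hyperplanes in a finite-dimensional real vector space V, the geometric realization of the order complex of the Salvetti poset Sal(A,V) is homotopy equivalent to V⊗C minus the union of the complexified hyperplanes H_e⊗C. -/
/-- Composition of sign vectors: `(X ∘ Y) e = X e` if `X e ≠ 0`, and `Y e` otherwise. -/
def scomp {E : Type*} (X Y : E → SignType) : E → SignType :=
  fun e => if X e = 0 then Y e else X e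

/-- The partial order on sign vectors: `X ≤ Y` iff `X ∘ Y = Y`. -/
def sle {E : Type*} (X Y : E → SignType) : Prop := scomp X Y = Y

theorem sle_refl {E : Type*} (X : E → SignType) : sle X X := by
  funext e; show (if X e = 0 then X e else X e) = X e; split <;> rfl

theorem sle_trans {E : Type*} {X Y Z : E → SignType} (h₁ : sle X Y) (h₂ : sle Y Z) :
    sle X Z := by
  funext e
  have h1 := congrFun h₁ e
  have h2 := congrFun h₂ e
  revert h1 h2
  show (if X e = 0 then Y e else X e) = Y e → (if Y e = 0 then Z e else Y e) = Z e →
    (if X e = 0 then Z e else X e) = Z e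
  generalize X e = a; generalize Y e = b; generalize Z e = c
  revert a b c; decide

theorem sle_antisymm {E : Type*} {X Y : E → SignType} (h₁ : sle X Y) (h₂ : sle Y X) :
    X = Y := by
  funext e
  have h1 := congrFun h₁ e
  have h2 := congrFun h₂ e
  revert h1 h2
  show (if X e = 0 then Y e else X e) = Y e → (if Y e = 0 then X e else Y e) = X e → X e = Y e
  generalize X e = a; generalize Y e = b
  revert a b; decide

/-- The separating set of two sign vectors: the indices where they take opposite
nonzero signs. -/
def SepSet {E : Type*} (X Y : E → SignType) : Set E :=
  {e | (X e = 1 ∧ Y e = -1) ∨ (X e = -1 ∧ Y e = 1)}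

section Geometry

variable {E : Type*} {V : Type*} [NormedAddCommGroup V] [NormedSpace ℝ V]

/-- The face of a sign vector `X`, relative to the family of cooriented affine hyperplanes
`H_e = {v | f e v = 0}`, with positive side `H_e⁺ = {v | f e v > 0}` and negative side
`H_e⁻ = {v | f e v < 0}`. -/
def face (f : E → (V →ᵃ[ℝ] ℝ)) (X : E → SignType) : Set V :=
  {v | ∀ e, SignType.sign (f e v) = X e}

/-- The conditional oriented matroid `L(A,K)`: the set of sign vectors whose face
meets `K`. -/
def covs (f : E → (V →ᵃ[ℝ] ℝ)) (K : Set V) : Set (E → SignType) :=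
  {X | (face f X ∩ K).Nonempty}

/-- A tope of `L(A,K)`: a maximal covector. -/
def IsTope (f : E → (V →ᵃ[ℝ] ℝ)) (K : Set V) (T : E → SignType) : Prop :=
  T ∈ covs f K ∧ ∀ Y ∈ covs f K, sle T Y → Y = T

/-- The set of topes of `L(A,K)`, as a type carrying the discrete topology. -/
def Topes (f : E → (V →ᵃ[ℝ] ℝ)) (K : Set V) : Type _ := {T : E → SignType // IsTope f K T}

instance (f : E → (V →ᵃ[ℝ] ℝ)) (K : Set V) : TopologicalSpace (Topes f K) := ⊥

instance (f : E → (V →ᵃ[ℝ] ℝ)) (K : Set V) : DiscreteTopology (Topes f K) := ⟨rfl⟩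

/-- Points of `K × T(A,K)`. -/
abbrev ZPre (f : E → (V →ᵃ[ℝ] ℝ)) (K : Set V) : Type _ := K × Topes f K

/-- The gluing relation defining `Z(A,K)`: `(v,T) ∼ (v',T')` iff `v = v'` and `v` lies on
no hyperplane separating `T` from `T'`. -/
def ZRel (f : E → (V →ᵃ[ℝ] ℝ)) (K : Set V) : ZPre f K → ZPre f K → Prop :=
  fun p q => (p.1 : V) = (q.1 : V) ∧ ∀ e ∈ SepSet p.2.1 q.2.1, f e (p.1 : V) ≠ 0

/-- The space `Z(A,K)`: one copy of `K` for each tope, glued along the complement of the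
separating hyperplanes, with the quotient topology. -/
def ZSpace (f : E → (V →ᵃ[ℝ] ℝ)) (K : Set V) : Type _ := Quot (ZRel f K)

instance (f : E → (V →ᵃ[ℝ] ℝ)) (K : Set V) : TopologicalSpace (ZSpace f K) :=
  inferInstanceAs (TopologicalSpace (Quot (ZRel f K)))

/-- The projection `π : Z(A,K) → V` (with image `K`), sending `[(v,T)]` to `v`. -/
def Zproj (f : E → (V →ᵃ[ℝ] ℝ)) (K : Set V) : ZSpace f K → V :=
  Quot.lift (fun p => (p.1 : V)) (fun _ _ h => h.1)

/-- The set `K_{X,T} = K ∩ ⋂_{e : X_e = 0} H_e^{T_e}`. -/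
def KXT (f : E → (V →ᵃ[ℝ] ℝ)) (K : Set V) (X T : E → SignType) : Set V :=
  K ∩ ⋂ e ∈ {e | X e = 0}, {v | SignType.sign (f e v) = T e}

/-- The subset `U_{X,T} ⊆ Z(A,K)`: the image of `K_{X,T} × {T}` under the quotient map. -/
def UXT (f : E → (V →ᵃ[ℝ] ℝ)) (K : Set V) (X : E → SignType) (T : Topes f K) :
    Set (ZSpace f K) :=
  {z | ∃ (v : V) (hv : v ∈ K), v ∈ KXT f K X T.1 ∧ z = Quot.mk (ZRel f K) (⟨v, hv⟩, T)}

/-- The complexified complement `M(A,K)`, where `V ⊗ ℂ` is modeled as `V × V` (real and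
imaginary parts): `v + iw` lies on `H_e ⊗ ℂ` iff `f e v = 0` and the linear part of `f e`
vanishes on `w`. -/
def MSpace (f : E → (V →ᵃ[ℝ] ℝ)) (K : Set V) : Type _ :=
  {p : V × V // p.1 ∈ K ∧ ∀ e, ¬(f e p.1 = 0 ∧ (f e).linear p.2 = 0)}

instance (f : E → (V →ᵃ[ℝ] ℝ)) (K : Set V) : TopologicalSpace (MSpace f K) :=
  inferInstanceAs (TopologicalSpace {p : V × V // p.1 ∈ K ∧ _})

/-- The projection `ρ : M(A,K) → V` (with image `K`), sending `v + iw` to `v`. -/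
def Mproj (f : E → (V →ᵃ[ℝ] ℝ)) (K : Set V) : MSpace f K → V := fun p => p.1.1

end Geometry

/-- The Salvetti poset `Sal(A,K)`: pairs `(X,T)` where `T` is a tope of `L(A,K)` and
`X ≤ T`. -/
@[ext]
structure SalP {E : Type*} {V : Type*} [NormedAddCommGroup V] [NormedSpace ℝ V]
    (f : E → (V →ᵃ[ℝ] ℝ)) (K : Set V) where
  X : E → SignType
  T : E → SignType
  memX : X ∈ covs f K
  topeT : IsTope f K T
  leXT : sle X T

/-- The partial order on the Salvetti poset: `(X,T) ⪯ (X',T')` iff `X ≤ X'` and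
`X' ∘ T = T'`. -/
instance {E : Type*} {V : Type*} [NormedAddCommGroup V] [NormedSpace ℝ V]
    (f : E → (V →ᵃ[ℝ] ℝ)) (K : Set V) : PartialOrder (SalP f K) where
  le p q := sle p.X q.X ∧ scomp q.X p.T = q.T
  le_refl p := ⟨sle_refl p.X, p.leXT⟩
  le_trans p q r h₁ h₂ := by
    refine ⟨sle_trans h₁.1 h₂.1, ?_⟩
    funext e
    have hc1 := congrFun h₁.2 e
    have hc2 := congrFun h₂.2 e
    have hc3 := congrFun h₂.1 e
    revert hc1 hc2 hc3
    show (if q.X e = 0 then p.T e else q.X e) = q.T e →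
      (if r.X e = 0 then q.T e else r.X e) = r.T e →
      (if q.X e = 0 then r.X e else q.X e) = r.X e →
      (if r.X e = 0 then p.T e else r.X e) = r.T e
    generalize q.X e = a; generalize p.T e = b; generalize q.T e = c
    generalize r.X e = d; generalize r.T e = g
    revert a b c d g; decide
  le_antisymm p q h₁ h₂ := by
    have hX : p.X = q.X := sle_antisymm h₁.1 h₂.1
    have hT : q.T = p.T := by rw [← h₁.2, hX.symm]; exact p.leXT
    ext1 <;> simp [hX, hT.symm]

open CategoryTheory in
/-- The order complex of a poset `P`: the geometric realization of the simplicial complex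
whose simplices are the chains in `P` (implemented as the realization of the nerve of `P`,
which has the same homotopy type). -/
noncomputable def orderComplex (P : Type) [PartialOrder P] : TopCat :=
  SSet.toTop.obj (CategoryTheory.nerve P)

section Realization

open CategoryTheory Simplicial Opposite

/-- The characteristic map of the (possibly degenerate) simplex of a monotone family `σ`. -/
noncomputable def orderComplex.simplexMap {P : Type} [PartialOrder P] {n : ℕ} (σ : Fin (n + 1) →o P) :
    C(stdSimplex ℝ (Fin (n + 1)), orderComplex P) :=
  TopCat.toSSetObjEquiv _ (op ⦋n⦌)
    ((sSetTopAdj.unit.app (nerve P)).app (op ⦋n⦌) σ.monotone.functor)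

theorem orderComplex.simplexMap_comp {P : Type} [PartialOrder P] {m n : ℕ}
    (σ : Fin (n + 1) →o P) (ρ : Fin (m + 1) →o Fin (n + 1)) (u : stdSimplex ℝ (Fin (m + 1))) :
    simplexMap (σ.comp ρ) u = simplexMap σ (stdSimplex.map ρ u) := by
  have h := (sSetTopAdj.unit.app (nerve P)).naturality (SimplexCategory.mkHom ρ).op
  have h' := ConcreteCategory.congr_hom h (σ.monotone.functor : ComposableArrows P n)
  have h2 := congrArg (fun s => TopCat.toSSetObjEquiv _ (op ⦋m⦌) s u) h'
  exact h2

theorem orderComplex.exists_desc {P : Type} [PartialOrder P] (X : Type) [TopologicalSpace X]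
    (c : ∀ n : ℕ, (Fin (n + 1) →o P) → C(stdSimplex ℝ (Fin (n + 1)), X))
    (hc : ∀ (m n : ℕ) (σ : Fin (n + 1) →o P) (ρ : Fin (m + 1) →o Fin (n + 1))
      (u : stdSimplex ℝ (Fin (m + 1))), c m (σ.comp ρ) u = c n σ (stdSimplex.map ρ u)) :
    ∃ G : C(orderComplex P, X), ∀ (n : ℕ) (σ : Fin (n + 1) →o P) (u),
      G (simplexMap σ u) = c n σ u := by
  let F : nerve P ⟶ TopCat.toSSet.obj (TopCat.of X) :=
    { app := fun k => ↾fun (s : ComposableArrows P k.unop.len) =>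
        (TopCat.toSSetObjEquiv (TopCat.of X) k).symm (c k.unop.len ⟨s.obj, s.monotone⟩)
      naturality := by
        intro k l r
        ext s
        apply (TopCat.toSSetObjEquiv (TopCat.of X) l).injective
        ext u
        exact hc _ _ ⟨s.obj, s.monotone⟩ (r.unop.toOrderHom) u }
  refine ⟨((sSetTopAdj.homEquiv _ _).symm F).hom, fun n σ u => ?_⟩
  have h := sSetTopAdj.homEquiv_unit (f := (sSetTopAdj.homEquiv _ _).symm F)
  rw [Equiv.apply_symm_apply] at h
  have h1 := congrArg (fun (F : nerve P ⟶ TopCat.toSSet.obj (TopCat.of X)) =>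
    TopCat.toSSetObjEquiv (TopCat.of X) (op ⦋n⦌) (F.app (op ⦋n⦌) σ.monotone.functor) u) h
  exact h1.symm

theorem orderComplex.hom_ext {P : Type} [PartialOrder P] {X : Type} [TopologicalSpace X]
    (G H : C(orderComplex P, X))
    (h : ∀ (n : ℕ) (σ : Fin (n + 1) →o P) (u), G (simplexMap σ u) = H (simplexMap σ u)) :
    G = H := by
  let G' : SSet.toTop.obj (nerve P) ⟶ TopCat.of X := TopCat.ofHom G
  let H' : SSet.toTop.obj (nerve P) ⟶ TopCat.of X := TopCat.ofHom H
  have : G' = H' := by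
    apply (sSetTopAdj.homEquiv _ _).injective
    rw [sSetTopAdj.homEquiv_unit, sSetTopAdj.homEquiv_unit]
    ext k s
    apply (TopCat.toSSetObjEquiv (TopCat.of X) k).injective
    ext u
    exact h _ ⟨s.obj, Functor.monotone s⟩ u
  exact congrArg TopCat.Hom.hom this

end Realization

theorem orderComplex.exists_simplexMap_eq {P : Type} [PartialOrder P] (z : orderComplex P) :
    ∃ (n : ℕ) (σ : Fin (n + 1) →o P) (u : stdSimplex ℝ (Fin (n + 1))), simplexMap σ u = z := by
  let A : Set (orderComplex P) :=
    {z | ∃ (n : ℕ) (σ : Fin (n + 1) →o P) (u : stdSimplex ℝ (Fin (n + 1))), simplexMap σ u = z}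
  obtain ⟨G, hG⟩ := exists_desc A
    (fun n σ => ⟨fun u => ⟨simplexMap σ u, n, σ, u, rfl⟩, by fun_prop⟩)
    (fun m n σ ρ u => Subtype.ext (simplexMap_comp σ ρ u))
  have h : (⟨Subtype.val, continuous_subtype_val⟩ : C(A, orderComplex P)).comp G =
      ContinuousMap.id _ :=
    hom_ext _ _ fun n σ u => congrArg Subtype.val (hG n σ u)
  have hz : (G z : orderComplex P) = z := DFunLike.congr_fun h z
  exact hz ▸ (G z).2

section StdSimplexMap

variable {ι κ : Type} [Fintype ι] [Fintype κ]

theorem stdSimplex.map_apply_eq_sum [DecidableEq κ] (g : ι → κ) (u : stdSimplex ℝ ι) (x : κ) :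
    stdSimplex.map g u x = ∑ i, if g i = x then u i else 0 := by
  rw [← Finset.sum_filter]
  exact FunOnFinite.linearMap_apply_apply _ _ _ _ _

theorem stdSimplex.map_apply_of_injective {g : ι → κ} (hg : Function.Injective g)
    (u : stdSimplex ℝ ι) (i : ι) : stdSimplex.map g u (g i) = u i := by
  classical
  rw [map_apply_eq_sum]
  simp [hg.eq_iff]

theorem stdSimplex.map_injective {g : ι → κ} (hg : Function.Injective g) :
    Function.Injective (stdSimplex.map g : stdSimplex ℝ ι → stdSimplex ℝ κ) := by
  intro u v h
  ext i
  rw [← map_apply_of_injective hg u, h, map_apply_of_injective hg]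

theorem stdSimplex.exists_of_map_apply_ne_zero {g : ι → κ} {u : stdSimplex ℝ ι} {x : κ}
    (hx : stdSimplex.map g u x ≠ 0) : ∃ i, g i = x := by
  classical
  rw [map_apply_eq_sum] at hx
  obtain ⟨i, -, hi⟩ := Finset.exists_ne_zero_of_sum_ne_zero hx
  exact ⟨i, by by_contra h; simp [h] at hi⟩

theorem stdSimplex.exists_map_eq {g : ι → κ} (hg : Function.Injective g) (t : stdSimplex ℝ κ)
    (ht : ∀ x, t x ≠ 0 → x ∈ Set.range g) : ∃ w, stdSimplex.map g w = t := by
  classical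
  have hsum : ∑ i, t (g i) = 1 := by
    rw [← stdSimplex.sum_eq_one t]
    exact Finset.sum_of_injOn g hg.injOn (by simp)
      (fun x _ hx => by_contra fun h => hx (by simpa using ht x h)) (fun _ _ => rfl)
  refine ⟨⟨fun i => t (g i), fun i => t.2.1 _, hsum⟩, ?_⟩
  ext x
  by_cases hx : x ∈ Set.range g
  · obtain ⟨i, rfl⟩ := hx
    rw [map_apply_of_injective hg]; rfl
  · rw [not_not.1 (mt (ht x) hx)]
    by_contra h
    exact hx (exists_of_map_apply_ne_zero h)

end StdSimplexMap

/-- The order complex of a finite poset in barycentric coordinates: formal convex combinations of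
elements of `P` whose support is a chain. -/
def ChainSimplex (P : Type) [PartialOrder P] [Fintype P] : Type :=
  {t : stdSimplex ℝ P // ∀ x y, t x ≠ 0 → t y ≠ 0 → x ≤ y ∨ y ≤ x}

instance (P : Type) [PartialOrder P] [Fintype P] : TopologicalSpace (ChainSimplex P) :=
  inferInstanceAs (TopologicalSpace (Subtype _))

instance (P : Type) [PartialOrder P] [Fintype P] : T2Space (ChainSimplex P) :=
  inferInstanceAs (T2Space (Subtype _))

theorem exists_orderHom_range_eq {P : Type} [PartialOrder P] (c : Finset P) (hc : c.Nonempty)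
    (h : ∀ x ∈ c, ∀ y ∈ c, x ≤ y ∨ y ≤ x) :
    ∃ (m : ℕ) (τ : Fin (m + 1) →o P), Function.Injective τ ∧ Set.range τ = c := by
  classical
  let c' : Finset (LinearExtension P) := c.map ⟨toLinearExtension, fun _ _ h => h⟩
  have hcard : c'.card = (c.card - 1) + 1 := by
    have := hc.card_pos
    rw [Finset.card_map]; omega
  let e := c'.orderEmbOfFin hcard
  have hmem : ∀ i, (e i : P) ∈ c := fun i => by
    have := c'.orderEmbOfFin_mem hcard i
    obtain ⟨x, hx, hxe⟩ := Finset.mem_map.1 this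
    exact hxe ▸ hx
  refine ⟨c.card - 1, ⟨fun i => (e i : P), fun i j hij => ?_⟩, e.injective, ?_⟩
  · refine (h _ (hmem i) _ (hmem j)).elim id fun h1 => ?_
    have h2 : e j ≤ e i := (toLinearExtension (α := P)).monotone h1
    have h3 : (e i : P) = e j := le_antisymm (α := LinearExtension P) (e.monotone hij) h2
    exact le_of_eq h3
  · have := c'.range_orderEmbOfFin hcard
    ext x
    constructor
    · rintro ⟨i, rfl⟩; exact hmem i
    · intro hx
      have : (toLinearExtension x) ∈ Set.range e := by
        rw [this]; exact Finset.mem_coe.2 (Finset.mem_map_of_mem _ hx)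
      exact this

theorem OrderHom.exists_comp_eq {P α β : Type} [PartialOrder P] [PartialOrder α] [LinearOrder β]
    (σ : α →o P) (τ : β →o P) (hτ : Function.Injective τ) (h : Set.range σ ⊆ Set.range τ) :
    ∃ ρ : α →o β, τ.comp ρ = σ := by
  choose ρ hρ using fun i => h ⟨i, rfl⟩
  refine ⟨⟨ρ, fun i j hij => ?_⟩, OrderHom.ext _ _ (funext hρ)⟩
  by_contra! hlt
  refine hlt.ne (hτ (le_antisymm (τ.monotone hlt.le) ?_))
  rw [hρ, hρ]
  exact σ.monotone hij

namespace orderComplex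

variable {P : Type} [PartialOrder P] [Fintype P]

theorem simplexMap_eq_of_range_eq_support {m n : ℕ} (σ : Fin (n + 1) →o P)
    (u : stdSimplex ℝ (Fin (n + 1))) (τ : Fin (m + 1) →o P) (hτ : Function.Injective τ)
    (hr : Set.range τ = {x | stdSimplex.map σ u x ≠ 0}) :
    ∃ w, stdSimplex.map τ w = stdSimplex.map σ u ∧ simplexMap σ u = simplexMap τ w := by
  classical
  obtain ⟨k, τ', hτ', hr'⟩ := exists_orderHom_range_eq (Finset.univ.image σ)
    (Finset.univ_nonempty.image _) (by
      simp only [Finset.mem_image, Finset.mem_univ, true_and]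
      rintro _ ⟨i, rfl⟩ _ ⟨j, rfl⟩
      exact (le_total i j).imp (fun h => σ.monotone h) (fun h => σ.monotone h))
  have hσr : Set.range σ = Set.range τ' := by rw [hr']; simp
  obtain ⟨ρ, hρ⟩ := OrderHom.exists_comp_eq σ τ' hτ' hσr.le
  obtain ⟨δ, hδ⟩ := OrderHom.exists_comp_eq τ τ' hτ' (by
    rw [hr, ← hσr]
    exact fun x hx => stdSimplex.exists_of_map_apply_ne_zero hx)
  obtain ⟨w, hw⟩ := stdSimplex.exists_map_eq hτ (stdSimplex.map σ u) (fun x hx => hr.ge hx)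
  refine ⟨w, hw, ?_⟩
  have : stdSimplex.map ρ u = stdSimplex.map δ w := by
    apply stdSimplex.map_injective hτ'
    rw [stdSimplex.map_comp_apply, stdSimplex.map_comp_apply]
    change stdSimplex.map (τ'.comp ρ) u = stdSimplex.map (τ'.comp δ) w
    rw [hρ, hδ, hw]
  rw [← hρ, ← hδ, simplexMap_comp, simplexMap_comp, this]

theorem exists_homeomorph_chainSimplex : Nonempty (orderComplex P ≃ₜ ChainSimplex P) := by
  classical
  let coord (n : ℕ) (σ : Fin (n + 1) →o P) : C(stdSimplex ℝ (Fin (n + 1)), ChainSimplex P) :=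
    { toFun u := ⟨stdSimplex.map σ u, fun x y hx hy => by
        obtain ⟨i, rfl⟩ := stdSimplex.exists_of_map_apply_ne_zero hx
        obtain ⟨j, rfl⟩ := stdSimplex.exists_of_map_apply_ne_zero hy
        exact (le_total i j).imp (fun h => σ.monotone h) (fun h => σ.monotone h)⟩
      continuous_toFun := (stdSimplex.continuous_map σ).subtype_mk _ }
  obtain ⟨G, hG⟩ := exists_desc (ChainSimplex P) coord
    (fun m n σ ρ u => Subtype.ext (stdSimplex.map_comp_apply ρ σ u).symm)
  have supp_chain (t : ChainSimplex P) : ∃ (m : ℕ) (τ : Fin (m + 1) →o P),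
      Function.Injective τ ∧ Set.range τ = {x | t.1 x ≠ 0} := by
    obtain ⟨m, τ, hτ, hr⟩ := exists_orderHom_range_eq (Finset.univ.filter fun x => t.1 x ≠ 0)
      (by
        by_contra h
        have h0 : ∀ x, t.1 x = 0 := by simpa [Finset.filter_eq_empty_iff] using h
        simpa [h0] using stdSimplex.sum_eq_one t.1)
      (fun x hx y hy => t.2 x y (Finset.mem_filter.1 hx).2 (Finset.mem_filter.1 hy).2)
    exact ⟨m, τ, hτ, by rw [hr]; simp⟩
  have hbij : Function.Bijective G := by
    constructor
    · intro z z' h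
      obtain ⟨n, σ, u, rfl⟩ := exists_simplexMap_eq z
      obtain ⟨n', σ', u', rfl⟩ := exists_simplexMap_eq z'
      rw [hG, hG] at h
      have h' : stdSimplex.map σ u = stdSimplex.map σ' u' := congrArg Subtype.val h
      obtain ⟨m, τ, hτ, hr⟩ := supp_chain (G (simplexMap σ u))
      rw [hG] at hr
      obtain ⟨w, hw, hw1⟩ := simplexMap_eq_of_range_eq_support σ u τ hτ hr
      obtain ⟨w', hw', hw1'⟩ := simplexMap_eq_of_range_eq_support σ' u' τ hτ (h' ▸ hr)
      rw [hw1, hw1', stdSimplex.map_injective hτ (hw.trans (h'.trans hw'.symm))]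
    · intro t
      obtain ⟨m, τ, hτ, hr⟩ := supp_chain t
      obtain ⟨w, hw⟩ := stdSimplex.exists_map_eq hτ t.1 (fun x hx => hr.ge hx)
      exact ⟨simplexMap τ w, (hG m τ w).trans (Subtype.ext hw)⟩
  have hcompact : CompactSpace (orderComplex P) := by
    let I := {c : Finset P // ∃ (m : ℕ) (τ : Fin (m + 1) →o P),
      Function.Injective τ ∧ Set.range τ = c}
    choose m τ hτ hr using fun c : I => c.2
    have : ⋃ c : I, Set.range (simplexMap (τ c)) = Set.univ := by
      refine Set.eq_univ_of_forall fun z => Set.mem_iUnion.2 ?_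
      obtain ⟨n, σ, u, rfl⟩ := exists_simplexMap_eq z
      obtain ⟨m', τ', hτ', hr'⟩ := supp_chain (G (simplexMap σ u))
      rw [hG] at hr'
      let c : I := ⟨Finset.univ.image τ', m', τ', hτ', by simp⟩
      obtain ⟨w, -, hw⟩ := simplexMap_eq_of_range_eq_support σ u (τ c) (hτ c)
        ((hr c).trans ((by simp [c] : (c.1 : Set P) = Set.range τ').trans hr'))
      exact ⟨c, w, hw.symm⟩
    rw [← isCompact_univ_iff, ← this]
    exact isCompact_iUnion fun c => isCompact_range (simplexMap (τ c)).continuous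
  exact ⟨Continuous.homeoOfEquivCompactToT2 (f := Equiv.ofBijective G hbij) G.continuous⟩

end orderComplex

namespace ChainSimplex

variable {P : Type} [PartialOrder P] [Fintype P] {Y : Type*} [TopologicalSpace Y]

theorem exists_isGreatest (t : ChainSimplex P) : ∃ z, IsGreatest {x | t.1 x ≠ 0} z := by
  classical
  have hne : (Finset.univ.filter fun x => t.1 x ≠ 0).Nonempty := by
    by_contra h
    have h0 : ∀ x, t.1 x = 0 := by simpa [Finset.filter_eq_empty_iff] using h
    simpa [h0] using stdSimplex.sum_eq_one t.1
  obtain ⟨z, hz, hmax⟩ := Finset.exists_maximal hne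
  refine ⟨z, (Finset.mem_filter.1 hz).2, fun y hy => ?_⟩
  refine (t.2 y z hy (Finset.mem_filter.1 hz).2).elim id fun h => ?_
  exact hmax (Finset.mem_filter.2 ⟨Finset.mem_univ _, hy⟩) h

theorem continuous_apply (x : P) : Continuous fun t : ChainSimplex P => t.1 x :=
  (_root_.continuous_apply x).comp (continuous_subtype_val.comp continuous_subtype_val)

@[ext]
theorem ext {s t : ChainSimplex P} (h : ∀ x, s.1 x = t.1 x) : s = t :=
  Subtype.ext (stdSimplex.ext (funext h))

section OfSeparation

variable (a b : P → C(Y, ℝ)) (hab : ∀ x y, ¬ x ≤ y → ∀ m, b x m ≤ a y m)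
  (hpos : ∀ m, ∃ x, a x m < b x m)

omit [PartialOrder P] in
include hpos in
theorem sum_bump_pos (m : Y) : 0 < ∑ x, max 0 (b x m - a x m) := by
  obtain ⟨x, hx⟩ := hpos m
  exact Finset.sum_pos' (fun _ _ => le_max_left _ _)
    ⟨x, Finset.mem_univ _, lt_max_of_lt_right (sub_pos.2 hx)⟩

/-- The map to `ChainSimplex P` whose barycentric coordinates are the normalized positive parts
of `b x - a x`; the inequality `hab` forces their supports to be chains. -/
noncomputable def ofSeparation : C(Y, ChainSimplex P) where
  toFun m := ⟨⟨fun x => max 0 (b x m - a x m) / ∑ y, max 0 (b y m - a y m),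
      fun _ => div_nonneg (le_max_left _ _) (sum_bump_pos a b hpos m).le, by
        rw [← Finset.sum_div, div_self (sum_bump_pos a b hpos m).ne']⟩, by
      have key : ∀ x, max 0 (b x m - a x m) / ∑ y, max 0 (b y m - a y m) ≠ 0 →
          a x m < b x m := fun x hx => by
        by_contra! h
        exact hx (by rw [max_eq_left (sub_nonpos.2 h), zero_div])
      intro x y hx hy
      by_contra! h
      linarith [key x hx, key y hy, hab x y h.1 m, hab y x h.2 m]⟩
  continuous_toFun := by
    refine Continuous.subtype_mk (Continuous.subtype_mk (continuous_pi fun x => ?_) _) _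
    exact Continuous.div (by fun_prop) (by fun_prop) fun m => (sum_bump_pos a b hpos m).ne'

theorem ofSeparation_apply (m : Y) (x : P) : (ofSeparation a b hab hpos m).1 x =
    max 0 (b x m - a x m) / ∑ y, max 0 (b y m - a y m) := rfl

theorem lt_of_ofSeparation_ne_zero {m : Y} {x : P} (hx : (ofSeparation a b hab hpos m).1 x ≠ 0) :
    a x m < b x m := by
  by_contra! h
  exact hx (by rw [ofSeparation_apply, max_eq_left (sub_nonpos.2 h), zero_div])

end OfSeparation

open Classical in
theorem max_sum_ge_sub_sum_not_le (t : ChainSimplex P) (x : P) :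
    max 0 ((∑ y, if x ≤ y then t.1 y else 0) - ∑ y, if y ≤ x then 0 else t.1 y) = t.1 x := by
  have h0 : ∀ y, 0 ≤ t.1 y := fun y => stdSimplex.zero_le _ _
  rw [← Finset.sum_sub_distrib]
  by_cases hx : t.1 x = 0
  · rw [hx]
    refine max_eq_left (Finset.sum_nonpos fun y _ => ?_)
    by_cases h1 : x ≤ y <;> by_cases h2 : y ≤ x <;> simp [h1, h2, h0 y]
    rw [← le_antisymm h1 h2, hx]
  · rw [Finset.sum_eq_single x]
    · simp [h0 x]
    · intro y _ hyx
      by_cases hy : t.1 y = 0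
      · simp [hy]
      · rcases t.2 x y hx hy with h | h
        · have : ¬ y ≤ x := fun h' => hyx (le_antisymm h' h)
          simp [h, this]
        · have : ¬ x ≤ y := fun h' => hyx (le_antisymm h h')
          simp [h, this]
    · simp

open Classical in
theorem ofSeparation_homotopic_id (a b : P → C(ChainSimplex P, ℝ))
    (hab : ∀ x y, ¬ x ≤ y → ∀ t, b x t ≤ a y t) (hpos : ∀ t, ∃ x, a x t < b x t)
    (htop : ∀ t z, IsGreatest {x | t.1 x ≠ 0} z → a z t < b z t) :
    (ofSeparation a b hab hpos).Homotopic (ContinuousMap.id _) := by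
  let a₁ : P → ChainSimplex P → ℝ := fun x t => ∑ y, if y ≤ x then 0 else t.1 y
  let b₁ : P → ChainSimplex P → ℝ := fun x t => ∑ y, if x ≤ y then t.1 y else 0
  have ha₁ : ∀ x, Continuous (a₁ x) := fun x => continuous_finsetSum _ fun y _ => by
    split_ifs
    exacts [continuous_const, continuous_apply y]
  have hb₁ : ∀ x, Continuous (b₁ x) := fun x => continuous_finsetSum _ fun y _ => by
    split_ifs
    exacts [continuous_apply y, continuous_const]
  have hab₁ : ∀ x y, ¬ x ≤ y → ∀ t, b₁ x t ≤ a₁ y t := fun x y hxy t =>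
    Finset.sum_le_sum fun z _ => by
      have h0 : 0 ≤ t.1 z := stdSimplex.zero_le _ _
      by_cases h1 : x ≤ z <;> by_cases h2 : z ≤ y <;> simp [h1, h2, h0]
      exact absurd (h1.trans h2) hxy
  let aI : P → C(unitInterval × ChainSimplex P, ℝ) := fun x =>
    ⟨fun p => (1 - (p.1 : ℝ)) * a x p.2 + p.1 * a₁ x p.2, by have := ha₁ x; fun_prop⟩
  let bI : P → C(unitInterval × ChainSimplex P, ℝ) := fun x =>
    ⟨fun p => (1 - (p.1 : ℝ)) * b x p.2 + p.1 * b₁ x p.2, by have := hb₁ x; fun_prop⟩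
  have habI : ∀ x y, ¬ x ≤ y → ∀ p, bI x p ≤ aI y p := fun x y hxy p =>
    add_le_add (mul_le_mul_of_nonneg_left (hab x y hxy p.2) (sub_nonneg.2 p.1.2.2))
      (mul_le_mul_of_nonneg_left (hab₁ x y hxy p.2) p.1.2.1)
  have hposI : ∀ p, ∃ x, aI x p < bI x p := fun p => by
    obtain ⟨z, hz⟩ := exists_isGreatest p.2
    refine ⟨z, ?_⟩
    have h1 := htop _ _ hz
    have h2 : a₁ z p.2 < b₁ z p.2 := by
      have h3 := max_sum_ge_sub_sum_not_le p.2 z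
      by_contra! h
      exact hz.1 (by rw [← h3, max_eq_left (sub_nonpos.2 h)])
    change (1 - (p.1 : ℝ)) * a z p.2 + p.1 * a₁ z p.2 < (1 - (p.1 : ℝ)) * b z p.2 + p.1 * b₁ z p.2
    have h4 : (0 : ℝ) ≤ p.1 := p.1.2.1
    have h5 : (p.1 : ℝ) ≤ 1 := p.1.2.2
    rcases h4.eq_or_lt with h | h
    · rw [← h]; simpa using h1
    · exact add_lt_add_of_le_of_lt (mul_le_mul_of_nonneg_left h1.le (sub_nonneg.2 h5))
        (mul_lt_mul_of_pos_left h2 h)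
  refine ⟨⟨ofSeparation aI bI habI hposI, fun t => ?_, fun t => ?_⟩⟩
  · ext x
    simp only [ContinuousMap.toFun_eq_coe]
    rw [ofSeparation_apply, ofSeparation_apply]
    simp [aI, bI]
  · ext x
    simp only [ContinuousMap.toFun_eq_coe]
    rw [ofSeparation_apply]
    have : ∀ y, bI y (1, t) - aI y (1, t) =
      (∑ z, if y ≤ z then t.1 z else 0) - ∑ z, if z ≤ y then 0 else t.1 z := fun y => by
        simp [aI, bI, a₁, b₁]
    simp only [this, max_sum_ge_sub_sum_not_le, stdSimplex.sum_eq_one, div_one]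
    rfl

end ChainSimplex

section Stratification

open TopologicalSpace

variable {P : Type} [PartialOrder P] [Fintype P] {Y : Type*} [TopologicalSpace Y]

omit [Fintype P] in
theorem exists_continuous_separation [PseudoMetrizableSpace Y] (s : Y → P)
    (hs : ∀ x, IsOpen {m | x ≤ s m}) :
    ∃ a b : P → C(Y, ℝ), (∀ x y, ¬ x ≤ y → ∀ m, b x m ≤ a y m) ∧
      (∀ m x, a x m < b x m → x ≤ s m) ∧ ∀ m, a (s m) m < b (s m) m := by
  let := pseudoMetrizableSpacePseudoMetric Y
  let D : Set Y → C(Y, ℝ) := fun S => ⟨fun m => (min 1 (Metric.infEDist m S)).toReal, by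
    refine ENNReal.continuousOn_toReal.comp_continuous
      (continuous_const.min Metric.continuous_infEDist) fun m => ?_
    exact ne_top_of_le_ne_top ENNReal.one_ne_top (min_le_left _ _)⟩
  have hD : ∀ {S m}, m ∈ S → D S m = 0 := fun {S m} h => by
    simp [D, Metric.infEDist_zero_of_mem h]
  refine ⟨fun x => D {m | s m ≤ x}, fun x => D {m | ¬ x ≤ s m}, fun x y hxy m => ?_,
    fun m x h => ?_, fun m => ?_⟩
  · refine ENNReal.toReal_mono (ne_top_of_le_ne_top ENNReal.one_ne_top (min_le_left _ _))
      (min_le_min_left _ (Metric.infEDist_anti fun z hz h => hxy (h.trans hz)))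
  · by_contra hx
    rw [hD (S := {m | ¬ x ≤ s m}) hx] at h
    exact absurd h (not_lt.2 ENNReal.toReal_nonneg)
  · rw [hD (S := {n | s n ≤ s m}) (le_refl (s m))]
    refine ENNReal.toReal_pos (fun h => ?_)
      (ne_top_of_le_ne_top ENNReal.one_ne_top (min_le_left _ _))
    have hcl : IsClosed {n | ¬ s m ≤ s n} := (hs (s m)).isClosed_compl
    have h0 : Metric.infEDist m {n | ¬ s m ≤ s n} = 0 := by
      rcases min_choice 1 (Metric.infEDist m {n | ¬ s m ≤ s n}) with h' | h'
      · exact absurd (h'.symm.trans h) one_ne_zero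
      · exact h'.symm.trans h
    exact (Metric.mem_iff_infEDist_zero_of_closed hcl).2 h0 le_rfl

/-- A space stratified over a finite poset `P`, containing a copy of the order complex
compatible with the strata and such that every self-map not raising strata is homotopic to the
identity, is homotopy equivalent to the order complex. -/
theorem nonempty_homotopyEquiv_of_stratification [PseudoMetrizableSpace Y] (s : Y → P)
    (hs : ∀ x, IsOpen {m | x ≤ s m}) (g : C(ChainSimplex P, Y))
    (hg : ∀ t z, IsGreatest {x | t.1 x ≠ 0} z → s (g t) = z)
    (hY : ∀ F : C(Y, Y), (∀ m, s (F m) ≤ s m) → F.Homotopic (ContinuousMap.id Y)) :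
    Nonempty (ContinuousMap.HomotopyEquiv (orderComplex P) Y) := by
  obtain ⟨a, b, hab, hle, hlt⟩ := exists_continuous_separation s hs
  let h := ChainSimplex.ofSeparation a b hab fun m => ⟨s m, hlt m⟩
  obtain ⟨e⟩ := orderComplex.exists_homeomorph_chainSimplex (P := P)
  refine ⟨e.toHomotopyEquiv.trans ⟨g, h, ?_, hY _ fun m => ?_⟩⟩
  · exact ChainSimplex.ofSeparation_homotopic_id (fun x => (a x).comp g) (fun x => (b x).comp g)
      (fun x y hxy t => hab x y hxy (g t)) (fun t => ⟨s (g t), hlt (g t)⟩)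
      fun t z hz => by have := hlt (g t); rwa [hg t z hz] at this
  · obtain ⟨z, hz⟩ := (h m).exists_isGreatest
    rw [ContinuousMap.comp_apply, hg _ z hz]
    exact hle m z (ChainSimplex.lt_of_ofSeparation_ne_zero a b hab _ hz.1)

end Stratification

theorem sign_sum_smul_eq {ι : Type*} [Fintype ι] {t r : ι → ℝ} (ht : ∀ i, 0 ≤ t i) {c : SignType}
    (h : ∀ i, t i ≠ 0 → SignType.sign (r i) = 0 ∨ SignType.sign (r i) = c) {j : ι}
    (hj : t j ≠ 0) (hjc : SignType.sign (r j) = c) : SignType.sign (∑ i, t i * r i) = c := by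
  have htj : 0 < t j := (ht j).lt_of_ne' hj
  cases c with
  | zero =>
    refine sign_eq_zero_iff.2 (Finset.sum_eq_zero fun i _ => ?_)
    by_cases hi : t i = 0
    · rw [hi, zero_mul]
    · rw [sign_eq_zero_iff.1 ((h i hi).elim id id), mul_zero]
  | pos =>
    refine sign_eq_one_iff.2 (Finset.sum_pos' (fun i _ => ?_)
      ⟨j, Finset.mem_univ _, mul_pos htj (sign_eq_one_iff.1 hjc)⟩)
    by_cases hi : t i = 0
    · rw [hi, zero_mul]
    · rcases h i hi with h' | h'
      · rw [sign_eq_zero_iff.1 h', mul_zero]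
      · exact mul_nonneg (ht i) (sign_eq_one_iff.1 h').le
  | neg =>
    refine sign_eq_neg_one_iff.2 (Finset.sum_neg' (fun i _ => ?_)
      ⟨j, Finset.mem_univ _, mul_neg_of_pos_of_neg htj (sign_eq_neg_one_iff.1 hjc)⟩)
    by_cases hi : t i = 0
    · rw [hi, zero_mul]
    · rcases h i hi with h' | h'
      · rw [sign_eq_zero_iff.1 h', mul_zero]
      · exact mul_nonpos_of_nonneg_of_nonpos (ht i) (sign_eq_neg_one_iff.1 h').le

open Filter Topology in
theorem eventually_sign_add_mul (r l : ℝ) : ∀ᶠ ε in 𝓝[>] (0 : ℝ), SignType.sign (r + ε * l) =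
    if SignType.sign r = 0 then SignType.sign l else SignType.sign r := by
  have ht : Tendsto (fun ε : ℝ => r + ε * l) (𝓝[>] 0) (𝓝 r) := by
    have : Continuous fun ε : ℝ => r + ε * l := by fun_prop
    simpa using (this.tendsto 0).mono_left nhdsWithin_le_nhds
  rcases lt_trichotomy r 0 with hr | rfl | hr
  · filter_upwards [ht.eventually_lt_const hr] with ε hε
    simp [sign_neg hr, sign_neg hε]
  · filter_upwards [self_mem_nhdsWithin] with ε hε
    simp [sign_mul, sign_pos (Set.mem_Ioi.1 hε)]
  · filter_upwards [ht.eventually_const_lt hr] with ε hε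
    simp [sign_pos hr, sign_pos hε]

theorem isOpen_sign_comp_eq {Y : Type*} [TopologicalSpace Y] {r : Y → ℝ} (hr : Continuous r)
    {c : SignType} (hc : c ≠ 0) : IsOpen {m | SignType.sign (r m) = c} := by
  cases c with
  | zero => exact absurd rfl hc
  | pos =>
    have : {m | SignType.sign (r m) = 1} = {m | 0 < r m} := Set.ext fun m => sign_eq_one_iff
    exact this ▸ isOpen_lt continuous_const hr
  | neg =>
    have : {m | SignType.sign (r m) = -1} = {m | r m < 0} := Set.ext fun m => sign_eq_neg_one_iff
    exact this ▸ isOpen_lt hr continuous_const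

section Salvetti

open Set

variable {E : Type*} {V : Type*} [NormedAddCommGroup V] [NormedSpace ℝ V]

theorem exists_sign_eq_scomp [Finite E] (f : E → (V →ᵃ[ℝ] ℝ)) (v w : V) :
    ∃ u, ∀ e, SignType.sign (f e u) =
      scomp (fun e => SignType.sign (f e v)) (fun e => SignType.sign ((f e).linear w)) e := by
  have h := Filter.eventually_all.2 fun e => eventually_sign_add_mul (f e v) ((f e).linear w)
  obtain ⟨ε, hε⟩ := h.exists
  refine ⟨ε • w + v, fun e => ?_⟩
  have : f e (ε • w + v) = f e v + ε * (f e).linear w := by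
    rw [← vadd_eq_add, AffineMap.map_vadd, map_smul, vadd_eq_add, smul_eq_mul, add_comm]
  rw [this, hε e]
  rfl

theorem IsTope.ne_zero [Finite E] {f : E → (V →ᵃ[ℝ] ℝ)} (hf : ∀ e, (f e).linear ≠ 0)
    {T : E → SignType} (hT : IsTope f univ T) (e : E) : T e ≠ 0 := by
  intro he
  obtain ⟨⟨v, hv, -⟩, hmax⟩ := hT
  obtain ⟨w, hw⟩ : ∃ w, (f e).linear w ≠ 0 := by
    by_contra! h
    exact hf e (LinearMap.ext h)
  obtain ⟨u, hu⟩ := exists_sign_eq_scomp f v w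
  have hvT : (fun e => SignType.sign (f e v)) = T := funext hv
  rw [hvT] at hu
  have h := hmax _ ⟨u, hu, mem_univ _⟩ (by
    funext e
    simp only [scomp]
    split_ifs <;> rfl)
  have h1 := congrFun h e
  simp [scomp, he, hw] at h1

theorem isTope_of_ne_zero {f : E → (V →ᵃ[ℝ] ℝ)} {K : Set V} {T : E → SignType}
    (hT : T ∈ covs f K) (h : ∀ e, T e ≠ 0) : IsTope f K T :=
  ⟨hT, fun Y _ hY => by
    rw [← hY]
    funext e
    simp [scomp, h e]⟩

/-- The element of the Salvetti poset attached to a point `v + iw` of the complexified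
complement: the sign vector `X` of `v`, and the tope `X ∘ sign w` of the chamber containing
`v + εw` for small `ε > 0`. -/
noncomputable def salStratum [Finite E] (f : E → (V →ᵃ[ℝ] ℝ)) (m : MSpace f univ) : SalP f univ where
  X e := SignType.sign (f e m.1.1)
  T := scomp (fun e => SignType.sign (f e m.1.1)) fun e => SignType.sign ((f e).linear m.1.2)
  memX := ⟨m.1.1, fun _ => rfl, mem_univ _⟩
  topeT := by
    obtain ⟨u, hu⟩ := exists_sign_eq_scomp f m.1.1 m.1.2
    refine isTope_of_ne_zero ⟨u, hu, mem_univ _⟩ fun e => ?_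
    have := m.2.2 e
    simp only [scomp]
    split_ifs with h
    · exact fun h' => this ⟨sign_eq_zero_iff.1 h, sign_eq_zero_iff.1 h'⟩
    · exact h
  leXT := by
    funext e
    simp only [scomp]
    split_ifs <;> rfl

/-- The points of `V × V` satisfying the sign conditions of the stratum of `z`. -/
def salCell (f : E → (V →ᵃ[ℝ] ℝ)) (z : SalP f univ) : Set (V × V) :=
  {p | ∀ e, SignType.sign (f e p.1) = z.X e ∧
    (z.X e = 0 → SignType.sign ((f e).linear p.2) = z.T e)}

/-- The points of `V × V` satisfying a weak form of the sign conditions of the stratum of `z`,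
which holds on all lower strata. -/
def weakSalCell (f : E → (V →ᵃ[ℝ] ℝ)) (z : SalP f univ) : Set (V × V) :=
  {p | ∀ e, (SignType.sign (f e p.1) = 0 ∨ SignType.sign (f e p.1) = z.X e) ∧
    (z.X e = 0 → SignType.sign ((f e).linear p.2) = z.T e)}

theorem sum_smul_mem_salCell {f : E → (V →ᵃ[ℝ] ℝ)} {z : SalP f univ} {ι : Type*} [Fintype ι]
    {t : ι → ℝ} (ht : ∀ i, 0 ≤ t i) (hsum : ∑ i, t i = 1) {q : ι → V × V}
    (h : ∀ i, t i ≠ 0 → q i ∈ weakSalCell f z) {j : ι} (hj : t j ≠ 0) (hq : q j ∈ salCell f z) :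
    ∑ i, t i • q i ∈ salCell f z := by
  intro e
  have h1 : f e (∑ i, t i • q i).1 = ∑ i, t i * f e (q i).1 := by
    have hdec : ∀ v, f e v = (f e).linear v + f e 0 := fun v => congrFun (f e).decomp v
    simp_rw [hdec (∑ i, t i • q i).1, hdec (q _).1, mul_add, Finset.sum_add_distrib,
      ← Finset.sum_mul, hsum, one_mul, Prod.fst_sum, map_sum, Prod.smul_fst, map_smul, smul_eq_mul]
  have h2 : (f e).linear (∑ i, t i • q i).2 = ∑ i, t i * (f e).linear (q i).2 := by
    simp_rw [Prod.snd_sum, map_sum, Prod.smul_snd, map_smul, smul_eq_mul]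
  rw [h1, h2]
  exact ⟨sign_sum_smul_eq ht (fun i hi => (h i hi e).1) hj (hq e).1,
    fun hX => sign_sum_smul_eq ht (fun i hi => Or.inr ((h i hi e).2 hX)) hj ((hq e).2 hX)⟩

theorem mem_weakSalCell_of_salStratum_le [Finite E] {f : E → (V →ᵃ[ℝ] ℝ)} {m : MSpace f univ}
    {z : SalP f univ} (h : salStratum f m ≤ z) : m.1 ∈ weakSalCell f z := by
  have key : ∀ a b c d : SignType, (if a = 0 then c else a) = c →
      (if c = 0 then (if a = 0 then b else a) else c) = d →
      (a = 0 ∨ a = c) ∧ (c = 0 → b = d) := by decide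
  exact fun e => key _ _ _ _ (congrFun h.1 e) (congrFun h.2 e)

theorem mem_salCell_salStratum [Finite E] {f : E → (V →ᵃ[ℝ] ℝ)} (m : MSpace f univ) :
    m.1 ∈ salCell f (salStratum f m) := by
  refine fun e => ⟨rfl, fun h => ?_⟩
  have h' : SignType.sign (f e m.1.1) = 0 := h
  simp [salStratum, scomp, h']

theorem exists_salStratum_eq [Finite E] {f : E → (V →ᵃ[ℝ] ℝ)} (hf : ∀ e, (f e).linear ≠ 0)
    {z : SalP f univ} {p : V × V} (hp : p ∈ salCell f z) :
    ∃ h, salStratum f ⟨p, h⟩ = z := by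
  refine ⟨⟨mem_univ _, fun e he => ?_⟩, ?_⟩
  · refine z.topeT.ne_zero hf e ?_
    rw [← (hp e).2 ((hp e).1 ▸ sign_eq_zero_iff.2 he.1), he.2, sign_zero]
  · refine SalP.ext (funext fun e => (hp e).1) (funext fun e => ?_)
    have h := congrFun z.leXT e
    simp only [scomp] at h
    simp only [salStratum, scomp, (hp e).1]
    split_ifs with hX
    · exact (hp e).2 hX
    · rwa [if_neg hX] at h

theorem salCell_nonempty (f : E → (V →ᵃ[ℝ] ℝ)) (z : SalP f univ) : (salCell f z).Nonempty := by
  obtain ⟨v, hv, -⟩ := z.memX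
  obtain ⟨u, hu, -⟩ := z.topeT.1
  refine ⟨(v, u - v), fun e => ⟨hv e, fun hX => ?_⟩⟩
  have hv0 : f e v = 0 := sign_eq_zero_iff.1 ((hv e).trans hX)
  have : (f e).linear (u - v) = f e u := by
    rw [← vsub_eq_sub, AffineMap.linearMap_vsub, hv0, vsub_eq_sub, sub_zero]
  rw [this, hu e]

theorem le_salStratum_iff [Finite E] {f : E → (V →ᵃ[ℝ] ℝ)} {z : SalP f univ} {m : MSpace f univ} :
    z ≤ salStratum f m ↔ ∀ e, (z.X e ≠ 0 → SignType.sign (f e m.1.1) = z.X e) ∧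
      (z.X e = 0 → f e m.1.1 ≠ 0 ∨ SignType.sign ((f e).linear m.1.2) = z.T e) := by
  have key : ∀ a b c d : SignType, ((if c = 0 then a else c) = a ∧
      (if a = 0 then d else a) = (if a = 0 then b else a)) ↔
      (c ≠ 0 → a = c) ∧ (c = 0 → a ≠ 0 ∨ b = d) := by decide
  change sle _ _ ∧ scomp _ _ = _ ↔ _
  rw [sle, funext_iff, funext_iff, ← forall_and]
  refine forall_congr' fun e => ?_
  rw [← sign_ne_zero (a := f e m.1.1)]
  exact key _ _ _ _

instance (f : E → (V →ᵃ[ℝ] ℝ)) (K : Set V) :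
    TopologicalSpace.PseudoMetrizableSpace (MSpace f K) :=
  inferInstanceAs (TopologicalSpace.PseudoMetrizableSpace {p : V × V // p.1 ∈ K ∧ _})

theorem MSpace.continuous_val (f : E → (V →ᵃ[ℝ] ℝ)) (K : Set V) :
    Continuous fun m : MSpace f K => m.1 :=
  continuous_subtype_val

theorem isOpen_le_salStratum [FiniteDimensional ℝ V] [Finite E] {f : E → (V →ᵃ[ℝ] ℝ)}
    (hf : ∀ e, (f e).linear ≠ 0) (z : SalP f univ) : IsOpen {m | z ≤ salStratum f m} := by
  simp only [le_salStratum_iff, ofPred_forall]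
  refine isOpen_iInter_of_finite fun e => ?_
  have h1 : Continuous fun m : MSpace f univ => f e m.1.1 :=
    (f e).continuous_of_finiteDimensional.comp (continuous_fst.comp (MSpace.continuous_val f _))
  have h2 : Continuous fun m : MSpace f univ => (f e).linear m.1.2 :=
    (f e).linear.continuous_of_finiteDimensional.comp
      (continuous_snd.comp (MSpace.continuous_val f _))
  by_cases hX : z.X e = 0
  · simp only [hX, ne_eq, not_true, false_imp_iff, true_imp_iff, true_and]
    exact (isOpen_ne_fun h1 continuous_const).union
      (isOpen_sign_comp_eq h2 (z.topeT.ne_zero hf e))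
  · simp only [hX, ne_eq, not_false_iff, false_imp_iff, true_imp_iff, and_true]
    exact isOpen_sign_comp_eq h1 hX

theorem homotopic_id_of_salStratum_le [Finite E] {f : E → (V →ᵃ[ℝ] ℝ)}
    (hf : ∀ e, (f e).linear ≠ 0) (F : C(MSpace f univ, MSpace f univ))
    (hF : ∀ m, salStratum f (F m) ≤ salStratum f m) : F.Homotopic (ContinuousMap.id _) := by
  have hmem : ∀ (t : unitInterval) (m : MSpace f univ),
      (1 - (t : ℝ)) • (F m).1 + (t : ℝ) • m.1 ∈
        {p : V × V | p.1 ∈ univ ∧ ∀ e, ¬(f e p.1 = 0 ∧ (f e).linear p.2 = 0)} := by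
    intro t m
    by_cases ht : (t : ℝ) = 0
    · rw [ht, sub_zero, one_smul, zero_smul, add_zero]
      exact (F m).2
    · have := sum_smul_mem_salCell (z := salStratum f m) (t := ![1 - (t : ℝ), t])
        (q := ![(F m).1, m.1]) (j := 1)
        (by simp [Fin.forall_fin_two, t.2.1, t.2.2]) (by simp)
        (by
          simp only [Fin.forall_fin_two]
          exact ⟨fun _ => mem_weakSalCell_of_salStratum_le (hF m),
            fun _ => mem_weakSalCell_of_salStratum_le le_rfl⟩)
        (by simpa using ht) (mem_salCell_salStratum m)
      rw [Fin.sum_univ_two] at this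
      exact (exists_salStratum_eq hf this).1
  have h1 := MSpace.continuous_val f univ
  refine ⟨⟨⟨fun p => ⟨_, hmem p.1 p.2⟩, Continuous.subtype_mk ?_ _⟩, fun m => ?_, fun m => ?_⟩⟩
  · have := h1.comp F.continuous
    fun_prop
  · exact Subtype.ext (by simp)
  · exact Subtype.ext (by simp)

theorem exists_chainSimplex_map {E V : Type} [NormedAddCommGroup V] [NormedSpace ℝ V] [Finite E]
    {f : E → (V →ᵃ[ℝ] ℝ)} (hf : ∀ e, (f e).linear ≠ 0) [Fintype (SalP f univ)] :
    ∃ g : C(ChainSimplex (SalP f univ), MSpace f univ),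
      ∀ t z, IsGreatest {x | t.1 x ≠ 0} z → salStratum f (g t) = z := by
  choose q hq using salCell_nonempty f
  have hweak : ∀ {x z}, x ≤ z → q x ∈ weakSalCell f z := fun {x z} h => by
    obtain ⟨h1, h2⟩ := exists_salStratum_eq hf (hq x)
    exact mem_weakSalCell_of_salStratum_le (m := ⟨q x, h1⟩) (h2.trans_le h)
  have hcell : ∀ (t : ChainSimplex (SalP f univ)) z, IsGreatest {x | t.1 x ≠ 0} z →
      ∑ x, t.1 x • q x ∈ salCell f z := fun t z hz =>
    sum_smul_mem_salCell (fun x => stdSimplex.zero_le t.1 x) (stdSimplex.sum_eq_one t.1)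
      (fun x hx => hweak (hz.2 hx)) hz.1 (hq z)
  have hmem : ∀ t : ChainSimplex (SalP f univ), (∑ x, t.1 x • q x) ∈
      {p : V × V | p.1 ∈ univ ∧ ∀ e, ¬(f e p.1 = 0 ∧ (f e).linear p.2 = 0)} := fun t => by
    obtain ⟨z, hz⟩ := t.exists_isGreatest
    exact (exists_salStratum_eq hf (hcell t z hz)).1
  refine ⟨⟨fun t => ⟨_, hmem t⟩, Continuous.subtype_mk ?_ _⟩, fun t z hz =>
    (exists_salStratum_eq hf (hcell t z hz)).2⟩
  exact continuous_finsetSum _ fun x _ => (ChainSimplex.continuous_apply x).smul continuous_const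

instance [Finite E] (f : E → (V →ᵃ[ℝ] ℝ)) (K : Set V) : Finite (SalP f K) :=
  Finite.of_injective (fun z : SalP f K => (z.X, z.T)) fun _ _ h =>
    SalP.ext (congrArg Prod.fst h) (congrArg Prod.snd h)

end Salvetti

variable {V : Type} [NormedAddCommGroup V] [NormedSpace ℝ V] [FiniteDimensional ℝ V]
variable {E : Type} [Fintype E]

/-- **Salvetti's theorem.**  For a finite collection `A = {H_e}` of cooriented affine
hyperplanes in a finite-dimensional real vector space `V` (given by affine functionals
`f e` with nonzero linear part), the Salvetti complex `|Sal(A,V)|` is homotopy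
equivalent to the complexified complement `M(A)`. -/
theorem salvetti_complex_homotopy_equiv_complement
    (f : E → (V →ᵃ[ℝ] ℝ)) (hf : ∀ e, (f e).linear ≠ 0) :
    Nonempty (ContinuousMap.HomotopyEquiv
      ↥(orderComplex (SalP f (Set.univ : Set V))) (MSpace f (Set.univ : Set V))) := by
  have := Fintype.ofFinite (SalP f (Set.univ : Set V))
  obtain ⟨g, hg⟩ := exists_chainSimplex_map hf
  exact nonempty_homotopyEquiv_of_stratification (salStratum f) (isOpen_le_salStratum hf) g hg
    (homotopic_id_of_salStratum_le hf)
end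

section
/- For any nonempty convex open subset K ⊆ V, the Salvetti complex |Sal(A,K)| is homotopy equivalent to the manifold M(A,K). -/
variable {V : Type} [NormedAddCommGroup V] [NormedSpace ℝ V] [FiniteDimensional ℝ V]
variable {E : Type} [Fintype E]

open CategoryTheory Opposite Simplicial in
/-- The characteristic map of the (possibly degenerate) simplex `σ` of the nerve of `P`. -/
noncomputable def nerveCell {P : Type} [PartialOrder P] {n : ℕ} (σ : Fin (n + 1) →o P) :
    C(stdSimplex ℝ (Fin (n + 1)), SSet.toTop.obj (nerve P)) :=
  TopCat.toSSetObjEquiv (SSet.toTop.obj (nerve P)) (op ⦋n⦌)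
    ((sSetTopAdj.unit.app (nerve P)).app (op ⦋n⦌) σ.monotone.functor)

open CategoryTheory Opposite Simplicial in
theorem nerveCell_comp {P : Type} [PartialOrder P] {m n : ℕ} (σ : Fin (n + 1) →o P)
    (g : Fin (m + 1) →o Fin (n + 1)) (t : stdSimplex ℝ (Fin (m + 1))) :
    nerveCell (σ.comp g) t = nerveCell σ (stdSimplex.map g t) := by
  have h := ConcreteCategory.congr_hom ((sSetTopAdj.unit.app (nerve P)).naturality
    (SimplexCategory.mkHom g).op) σ.monotone.functor
  have h2 := DFunLike.congr_fun
    (congrArg (TopCat.toSSetObjEquiv (SSet.toTop.obj (nerve P)) (op ⦋m⦌)) h) t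
  exact h2

open CategoryTheory Opposite Simplicial in
theorem nerveRealization_hom_ext {P : Type} [PartialOrder P] {Y : TopCat.{0}}
    {g h : SSet.toTop.obj (nerve P) ⟶ Y}
    (H : ∀ (n : ℕ) (σ : Fin (n + 1) →o P) t, g (nerveCell σ t) = h (nerveCell σ t)) : g = h := by
  apply (sSetTopAdj.homEquiv _ _).injective
  rw [Adjunction.homEquiv_unit, Adjunction.homEquiv_unit]
  ext n σ
  induction n using Opposite.rec with | _ n
  induction n using SimplexCategory.rec with | _ n
  apply (TopCat.toSSetObjEquiv Y (op ⦋n⦌)).injective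
  ext t
  exact H n ⟨σ.obj, σ.monotone⟩ t

/-- The order complex of a finite poset as a subspace of a standard simplex: the points whose
support is a chain. -/
abbrev OrderSimplex (P : Type) [PartialOrder P] [Fintype P] : Type :=
  {x : stdSimplex ℝ P // IsChain (· ≤ ·) {p | x p ≠ 0}}

theorem exists_of_stdSimplex_map_ne_zero {X Y : Type*} [Fintype X] [Fintype Y] (g : X → Y)
    (t : stdSimplex ℝ X) {y : Y} (h : stdSimplex.map g t y ≠ 0) : ∃ x, t x ≠ 0 ∧ g x = y := by
  classical
  rw [stdSimplex.map_coe, FunOnFinite.linearMap_apply_apply] at h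
  obtain ⟨x, hx, hx'⟩ := Finset.exists_ne_zero_of_sum_ne_zero h
  exact ⟨x, hx', by simpa using hx⟩

theorem stdSimplex_map_apply_ne_zero {X Y : Type*} [Fintype X] [Fintype Y] (g : X → Y)
    (t : stdSimplex ℝ X) {x : X} (h : t x ≠ 0) : stdSimplex.map g t (g x) ≠ 0 := by
  classical
  rw [stdSimplex.map_coe, FunOnFinite.linearMap_apply_apply]
  refine (lt_of_lt_of_le (lt_of_le_of_ne (stdSimplex.zero_le t x) h.symm) ?_).ne'
  exact Finset.single_le_sum (f := fun i => t i) (fun i _ => stdSimplex.zero_le t i) (by simp)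

theorem stdSimplex_map_injective {X Y : Type*} [Fintype X] [Fintype Y] {g : X → Y}
    (hg : Function.Injective g) :
    Function.Injective (stdSimplex.map g : stdSimplex ℝ X → stdSimplex ℝ Y) := by
  classical
  have key : ∀ (t : stdSimplex ℝ X) (x : X), stdSimplex.map g t (g x) = t x := by
    intro t x
    rw [stdSimplex.map_coe, FunOnFinite.linearMap_apply_apply, Finset.sum_eq_single x]
    · intro b hb hbx
      exact absurd (hg (by simpa using hb)) hbx
    · simp
  intro s t h
  ext x
  rw [← key s x, ← key t x, h]

theorem exists_stdSimplex_map_eq {X Y : Type*} [Fintype X] [Fintype Y] {g : X → Y}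
    (hg : Function.Injective g) (y : stdSimplex ℝ Y) (h : ∀ b, y b ≠ 0 → b ∈ Set.range g) :
    ∃ t : stdSimplex ℝ X, stdSimplex.map g t = y := by
  classical
  have hs : ∑ x, y (g x) = 1 := by
    rw [← stdSimplex.sum_eq_one y,
      ← Finset.sum_image (f := fun b => y b) (fun a _ b _ hab => hg hab)]
    refine Finset.sum_subset (Finset.subset_univ _) fun b _ hb => ?_
    by_contra hb'
    obtain ⟨x, rfl⟩ := h b hb'
    exact hb (Finset.mem_image_of_mem _ (Finset.mem_univ _))
  refine ⟨⟨fun x => y (g x), fun x => stdSimplex.zero_le y _, hs⟩, ?_⟩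
  ext b
  rw [stdSimplex.map_coe, FunOnFinite.linearMap_apply_apply]
  by_cases hb : b ∈ Set.range g
  · obtain ⟨x, rfl⟩ := hb
    rw [Finset.sum_eq_single x]
    · rfl
    · intro c hc hcx
      exact absurd (hg (by simpa using hc)) hcx
    · simp
  · rw [Finset.sum_eq_zero]
    · by_contra hb'
      exact hb (h b (Ne.symm hb'))
    · intro x hx
      exact absurd ⟨x, by simpa using hx⟩ hb

theorem exists_orderEmb_range {α : Type*} [PartialOrder α] (s : Finset α)
    (hs : IsChain (· ≤ ·) (s : Set α)) (hne : s.Nonempty) :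
    ∃ τ : Fin (s.card - 1 + 1) ↪o α, Set.range τ = s := by
  classical
  let _ : LinearOrder s :=
    { (inferInstance : PartialOrder s) with
      le_total := fun a b => hs.total a.2 b.2
      toDecidableLE := Classical.decRel _ }
  have hc : Fintype.card s = s.card - 1 + 1 := by
    rw [Fintype.card_coe]; have := hne.card_pos; omega
  let e := Fintype.orderIsoFinOfCardEq s hc
  refine ⟨e.toOrderEmbedding.trans (OrderEmbedding.subtype _), ?_⟩
  ext a
  constructor
  · rintro ⟨i, rfl⟩
    exact (e i).2
  · intro ha
    exact ⟨e.symm ⟨a, ha⟩, by simp⟩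

/-- The affine simplex of `OrderSimplex P` spanned by `σ`. -/
noncomputable def orderSimplexCell {P : Type} [PartialOrder P] [Fintype P] {n : ℕ}
    (σ : Fin (n + 1) →o P) (t : stdSimplex ℝ (Fin (n + 1))) : OrderSimplex P :=
  ⟨stdSimplex.map σ t, by
    intro p hp q hq _
    obtain ⟨i, -, rfl⟩ := exists_of_stdSimplex_map_ne_zero _ _ hp
    obtain ⟨j, -, rfl⟩ := exists_of_stdSimplex_map_ne_zero _ _ hq
    exact (le_total i j).imp (fun h => σ.monotone h) (fun h => σ.monotone h)⟩

theorem continuous_orderSimplexCell {P : Type} [PartialOrder P] [Fintype P] {n : ℕ}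
    (σ : Fin (n + 1) →o P) : Continuous (orderSimplexCell σ) :=
  (stdSimplex.continuous_map σ).subtype_mk _

theorem exists_support_emb {P : Type} [PartialOrder P] [Fintype P] (x : stdSimplex ℝ P)
    (hx : IsChain (· ≤ ·) {p | x p ≠ 0}) :
    ∃ n < Fintype.card P, ∃ τ : Fin (n + 1) ↪o P, Set.range τ = {p | x p ≠ 0} := by
  classical
  have hne : (Finset.univ.filter fun p => x p ≠ 0).Nonempty := by
    by_contra h
    have : ∀ p, x p = 0 := by simpa [Finset.filter_eq_empty_iff] using h
    have h1 := stdSimplex.sum_eq_one x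
    simp [this] at h1
  obtain ⟨τ, hτ⟩ := exists_orderEmb_range (Finset.univ.filter fun p => x p ≠ 0)
    (by simpa using hx) hne
  refine ⟨_, ?_, τ, by simpa using hτ⟩
  have := Finset.card_le_univ (Finset.univ.filter fun p => x p ≠ 0)
  have := hne.card_pos
  omega

theorem exists_orderSimplexCell {P : Type} [PartialOrder P] [Fintype P] (x : OrderSimplex P) :
    ∃ n < Fintype.card P, ∃ (σ : Fin (n + 1) →o P) (t : _), orderSimplexCell σ t = x := by
  obtain ⟨n, hn, τ, hτ⟩ := exists_support_emb x.1 x.2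
  obtain ⟨t, ht⟩ := exists_stdSimplex_map_eq τ.injective x.1 fun b hb => by rw [hτ]; exact hb
  exact ⟨n, hn, τ.toOrderHom, t, Subtype.ext ht⟩

theorem nerveCell_eq_of_emb {P : Type} [PartialOrder P] [Fintype P] {m n : ℕ}
    (τ : Fin (m + 1) ↪o P) (u : stdSimplex ℝ (Fin (m + 1)))
    (σ : Fin (n + 1) →o P) (t : stdSimplex ℝ (Fin (n + 1)))
    (h : stdSimplex.map σ t = stdSimplex.map τ u) : nerveCell σ t = nerveCell τ.toOrderHom u := by
  classical
  obtain ⟨k, -, ι, hι⟩ := exists_support_emb t (fun i _ j _ _ => le_total i j)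
  obtain ⟨s, rfl⟩ := exists_stdSimplex_map_eq ι.injective t fun b hb => by rw [hι]; exact hb
  have hmem : ∀ i, σ (ι i) ∈ Set.range τ := by
    intro i
    have h1 : ι i ∈ {p | (stdSimplex.map ι s) p ≠ 0} := hι ▸ Set.mem_range_self i
    have h2 := stdSimplex_map_apply_ne_zero σ _ h1
    rw [h] at h2
    obtain ⟨x, -, hx⟩ := exists_of_stdSimplex_map_ne_zero _ _ h2
    exact ⟨x, hx⟩
  choose π hπ using hmem
  let g : Fin (k + 1) →o Fin (m + 1) := ⟨π, fun i j hij => by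
    rw [← τ.le_iff_le, hπ, hπ]
    exact σ.monotone (ι.monotone hij)⟩
  have hg : σ.comp ι.toOrderHom = τ.toOrderHom.comp g := by
    ext i
    exact (hπ i).symm
  have hgs : stdSimplex.map g s = u := by
    apply stdSimplex_map_injective τ.injective
    rw [← h, stdSimplex.map_comp_apply, stdSimplex.map_comp_apply]
    congr 1
    ext i
    exact hπ i
  calc nerveCell σ (stdSimplex.map ι s) = nerveCell (σ.comp ι.toOrderHom) s :=
        (nerveCell_comp σ ι.toOrderHom s).symm
    _ = nerveCell (τ.toOrderHom.comp g) s := by rw [hg]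
    _ = _ := by rw [nerveCell_comp, hgs]

theorem nerveCell_eq {P : Type} [PartialOrder P] [Fintype P] {m n : ℕ}
    (σ : Fin (n + 1) →o P) (t : stdSimplex ℝ (Fin (n + 1)))
    (σ' : Fin (m + 1) →o P) (t' : stdSimplex ℝ (Fin (m + 1)))
    (h : orderSimplexCell σ t = orderSimplexCell σ' t') : nerveCell σ t = nerveCell σ' t' := by
  obtain ⟨k, -, τ, hτ⟩ := exists_support_emb _ (orderSimplexCell σ t).2
  obtain ⟨u, hu⟩ := exists_stdSimplex_map_eq τ.injective (orderSimplexCell σ t).1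
    fun b hb => by rw [hτ]; exact hb
  rw [nerveCell_eq_of_emb τ u σ t hu.symm,
    nerveCell_eq_of_emb τ u σ' t' (hu.trans (congrArg Subtype.val h)).symm]

/-- A point of the chain model, as a point of the realization of the nerve. -/
noncomputable def orderSimplexToRealization {P : Type} [PartialOrder P] [Fintype P]
    (x : OrderSimplex P) : SSet.toTop.obj (CategoryTheory.nerve P) :=
  nerveCell (exists_orderSimplexCell x).choose_spec.2.choose
    (exists_orderSimplexCell x).choose_spec.2.choose_spec.choose

theorem orderSimplexToRealization_cell {P : Type} [PartialOrder P] [Fintype P] {n : ℕ}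
    (σ : Fin (n + 1) →o P) (t : stdSimplex ℝ (Fin (n + 1))) :
    orderSimplexToRealization (orderSimplexCell σ t) = nerveCell σ t :=
  nerveCell_eq _ _ _ _
    (exists_orderSimplexCell (orderSimplexCell σ t)).choose_spec.2.choose_spec.choose_spec

theorem continuous_orderSimplexToRealization {P : Type} [PartialOrder P] [Fintype P] :
    Continuous (orderSimplexToRealization (P := P)) := by
  have (n : ℕ) : Finite (Fin (n + 1) →o P) := DFunLike.finite _
  let q : (Σ a : (Σ n : Fin (Fintype.card P), (Fin (n.1 + 1) →o P)),
      stdSimplex ℝ (Fin (a.1.1 + 1))) → OrderSimplex P := fun z => orderSimplexCell z.1.2 z.2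
  have hq : Continuous q := continuous_sigma fun a => continuous_orderSimplexCell a.2
  have hsurj : Function.Surjective q := by
    intro x
    obtain ⟨n, hn, σ, t, h⟩ := exists_orderSimplexCell x
    exact ⟨⟨⟨⟨n, hn⟩, σ⟩, t⟩, h⟩
  rw [(Topology.IsQuotientMap.of_surjective_continuous hsurj hq).continuous_iff]
  refine continuous_sigma fun a => ?_
  have : (fun t => (orderSimplexToRealization ∘ q) ⟨a, t⟩) = nerveCell a.2 :=
    funext fun t => orderSimplexToRealization_cell a.2 t
  rw [this]
  exact (nerveCell a.2).continuous

open CategoryTheory Opposite Simplicial in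
/-- A simplex of the nerve determines an affine singular simplex of the chain model. -/
noncomputable def nerveToSingular (P : Type) [PartialOrder P] [Fintype P] :
    nerve P ⟶ TopCat.toSSet.obj (TopCat.of (OrderSimplex P)) where
  app n := ↾fun (σ : ComposableArrows P n.unop.len) =>
    (TopCat.toSSetObjEquiv (TopCat.of (OrderSimplex P)) n).symm
      ⟨orderSimplexCell ⟨σ.obj, σ.monotone⟩, continuous_orderSimplexCell _⟩
  naturality m n g := by
    ext σ
    apply (TopCat.toSSetObjEquiv (TopCat.of (OrderSimplex P)) n).injective
    apply ContinuousMap.ext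
    intro t
    apply Subtype.ext
    exact (stdSimplex.map_comp_apply (SimplexCategory.Hom.toOrderHom g.unop)
      (show ComposableArrows P m.unop.len from σ).obj t).symm

open CategoryTheory Opposite Simplicial in
/-- The realization of the nerve maps to the chain model, affinely on each simplex. -/
noncomputable def realizationToOrderSimplex (P : Type) [PartialOrder P] [Fintype P] :
    SSet.toTop.obj (nerve P) ⟶ TopCat.of (OrderSimplex P) :=
  (sSetTopAdj.homEquiv _ _).symm (nerveToSingular P)

open CategoryTheory Opposite Simplicial in
theorem realizationToOrderSimplex_cell {P : Type} [PartialOrder P] [Fintype P] {n : ℕ}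
    (σ : Fin (n + 1) →o P) (t : stdSimplex ℝ (Fin (n + 1))) :
    realizationToOrderSimplex P (nerveCell σ t) = orderSimplexCell σ t := by
  have h : sSetTopAdj.unit.app (nerve P) ≫ TopCat.toSSet.map (realizationToOrderSimplex P) =
      nerveToSingular P := by
    exact (Adjunction.homEquiv_unit _ _ _ _).symm.trans (Equiv.apply_symm_apply _ _)
  have h2 := ConcreteCategory.congr_hom (NatTrans.congr_app h (op ⦋n⦌)) σ.monotone.functor
  exact DFunLike.congr_fun
    (congrArg (TopCat.toSSetObjEquiv (TopCat.of (OrderSimplex P)) (op ⦋n⦌)) h2) t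

/-- The realization of the nerve of a finite poset is homeomorphic to the chain model. -/
noncomputable def realizationHomeomorph (P : Type) [PartialOrder P] [Fintype P] :
    SSet.toTop.obj (CategoryTheory.nerve P) ≃ₜ OrderSimplex P where
  toFun := realizationToOrderSimplex P
  invFun := orderSimplexToRealization
  left_inv x := by
    have : CategoryTheory.CategoryStruct.comp (realizationToOrderSimplex P)
          (TopCat.ofHom ⟨_, continuous_orderSimplexToRealization⟩) =
        CategoryTheory.CategoryStruct.id _ := nerveRealization_hom_ext fun n σ t => by
      change orderSimplexToRealization (realizationToOrderSimplex P (nerveCell σ t)) =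
        nerveCell σ t
      rw [realizationToOrderSimplex_cell, orderSimplexToRealization_cell]
    exact CategoryTheory.ConcreteCategory.congr_hom this x
  right_inv x := by
    obtain ⟨n, -, σ, t, rfl⟩ := exists_orderSimplexCell x
    rw [orderSimplexToRealization_cell, realizationToOrderSimplex_cell]
  continuous_toFun := (realizationToOrderSimplex P).hom.continuous
  continuous_invFun := continuous_orderSimplexToRealization

theorem exists_orderSimplex_map {P : Type} [PartialOrder P] [Fintype P] {X : Type*}
    [TopologicalSpace X] (g : P → X → ℝ) (hc : ∀ p, Continuous (g p)) (h0 : ∀ p x, 0 ≤ g p x)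
    (hne : ∀ x, ∃ p, g p x ≠ 0) (hchain : ∀ x, IsChain (· ≤ ·) {p | g p x ≠ 0}) :
    ∃ y : C(X, OrderSimplex P), ∀ x p, (y x).1 p ≠ 0 ↔ g p x ≠ 0 := by
  have hpos : ∀ x, 0 < ∑ p, g p x := fun x =>
    let ⟨p, hp⟩ := hne x
    Finset.sum_pos' (fun p _ => h0 p x) ⟨p, Finset.mem_univ _, (h0 p x).lt_of_ne' hp⟩
  have key : ∀ x p, g p x / ∑ q, g q x ≠ 0 ↔ g p x ≠ 0 := fun x p => by
    simp [(hpos x).ne']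
  refine ⟨⟨fun x => ⟨⟨fun p => g p x / ∑ q, g q x, fun p => div_nonneg (h0 p x) (hpos x).le, ?_⟩,
    ?_⟩, ?_⟩, key⟩
  · rw [← Finset.sum_div, div_self (hpos x).ne']
  · exact (hchain x).mono fun p hp => (key x p).1 hp
  · refine Continuous.subtype_mk (Continuous.subtype_mk ?_ _) _
    exact continuous_pi fun p => (hc p).div (continuous_finsetSum _ fun q _ => hc q)
      fun x => (hpos x).ne'

theorem OrderSimplex.homotopic_of_isChain {P : Type} [PartialOrder P] [Fintype P] {X : Type*}
    [TopologicalSpace X] (y z : C(X, OrderSimplex P))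
    (h : ∀ x, IsChain (· ≤ ·) ({p | (y x).1 p ≠ 0} ∪ {p | (z x).1 p ≠ 0})) :
    y.Homotopic z := by
  have hy : Continuous fun x => (y x).1.1 :=
    continuous_subtype_val.comp (continuous_subtype_val.comp y.continuous)
  have hz : Continuous fun x => (z x).1.1 :=
    continuous_subtype_val.comp (continuous_subtype_val.comp z.continuous)
  refine ⟨⟨⟨fun a => ⟨⟨(1 - (a.1 : ℝ)) • (y a.2).1.1 + (a.1 : ℝ) • (z a.2).1.1,
    convex_stdSimplex ℝ P (y a.2).1.2 (z a.2).1.2 (by linarith [a.1.2.2]) a.1.2.1 (by ring)⟩,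
    ?_⟩, ?_⟩, ?_, ?_⟩⟩
  · refine (h a.2).mono fun p hp => ?_
    by_contra hcon
    simp only [Set.mem_union, Set.mem_ofPred_eq, not_or, not_not] at hcon
    apply hp
    change (1 - (a.1 : ℝ)) * (y a.2).1 p + (a.1 : ℝ) * (z a.2).1 p = 0
    rw [hcon.1, hcon.2]
    ring
  · refine Continuous.subtype_mk (Continuous.subtype_mk ?_ _) _
    have h1 : Continuous fun a : unitInterval × X => (a.1 : ℝ) :=
      continuous_subtype_val.comp continuous_fst
    exact ((continuous_const.sub h1).smul (hy.comp continuous_snd)).add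
      (h1.smul (hz.comp continuous_snd))
  · intro x
    apply Subtype.ext
    apply Subtype.ext
    simp
  · intro x
    apply Subtype.ext
    apply Subtype.ext
    simp

theorem OrderSimplex.exists_max {P : Type} [PartialOrder P] [Fintype P] (x : OrderSimplex P) :
    ∃ p, x.1 p ≠ 0 ∧ ∀ q, x.1 q ≠ 0 → q ≤ p := by
  obtain ⟨n, -, τ, hτ⟩ := exists_support_emb x.1 x.2
  have hm : ∀ q, x.1 q ≠ 0 ↔ q ∈ Set.range τ := fun q => by rw [hτ]; rfl
  refine ⟨τ (Fin.last n), (hm _).2 ⟨_, rfl⟩, fun q hq => ?_⟩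
  obtain ⟨i, rfl⟩ := (hm q).1 hq
  exact τ.monotone (Fin.le_last i)

theorem OrderSimplex.exists_truncation {P : Type} [PartialOrder P] [Fintype P] {X : Type*}
    [TopologicalSpace X] (y : C(X, OrderSimplex P)) :
    ∃ ε > 0, ∃ y' : C(X, OrderSimplex P), ∀ x p, (y' x).1 p ≠ 0 → ε < (y x).1 p := by
  have hcoord : ∀ p, Continuous fun x => (y x).1 p := fun p => (continuous_apply p).comp
    (continuous_subtype_val.comp (continuous_subtype_val.comp y.continuous))
  have hε : (0 : ℝ) < 1 / (2 * (Fintype.card P + 1)) := by positivity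
  set ε : ℝ := 1 / (2 * (Fintype.card P + 1)) with hεdef
  have hiff : ∀ x p, max 0 ((y x).1 p - ε) ≠ 0 → ε < (y x).1 p := by
    intro x p hp
    by_contra hcon
    exact hp (max_eq_left (by linarith))
  obtain ⟨y', hy'⟩ := exists_orderSimplex_map (fun p x => max 0 ((y x).1 p - ε))
    (fun p => continuous_const.max ((hcoord p).sub continuous_const))
    (fun p x => le_max_left _ _)
    (fun x => by
      by_contra! hcon
      have h1 : ∀ p, (y x).1 p ≤ ε := fun p => by
        have := max_eq_left_iff.1 (hcon p); linarith
      have h2 : (1 : ℝ) ≤ Fintype.card P * ε := by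
        calc (1 : ℝ) = ∑ p, (y x).1 p := (stdSimplex.sum_eq_one _).symm
          _ ≤ ∑ _p : P, ε := Finset.sum_le_sum fun p _ => h1 p
          _ = _ := by simp
      have h3 : (2 * (Fintype.card P + 1)) * ε = 1 := by
        rw [hεdef]; field_simp
      have h4 : (0 : ℝ) ≤ Fintype.card P := by positivity
      nlinarith)
    (fun x => (y x).2.mono fun p hp => (hε.trans (hiff x p hp)).ne')
  exact ⟨ε, hε, y', fun x p hp => hiff x p ((hy' x p).1 hp)⟩

theorem OrderSimplex.homotopic_id_of_truncation {P : Type} [PartialOrder P] [Fintype P]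
    (y y' : C(OrderSimplex P, OrderSimplex P)) {ε : ℝ} (hε : 0 < ε)
    (hy' : ∀ x p, (y' x).1 p ≠ 0 → ε < (y x).1 p)
    (hy : ∀ x p, (∀ q, x.1 q ≠ 0 → q ≤ p) → ∀ q, (y x).1 q ≠ 0 → q ≤ p) :
    y'.Homotopic (ContinuousMap.id _) := by
  classical
  have hcoord : ∀ (w : C(OrderSimplex P, OrderSimplex P)) p, Continuous fun x => (w x).1 p :=
    fun w p => (continuous_apply p).comp
      (continuous_subtype_val.comp (continuous_subtype_val.comp w.continuous))
  let g : P → OrderSimplex P → ℝ := fun p x =>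
    x.1 p * ∏ q, if q ≤ p then 1 else max 0 (ε - (y x).1 q)
  have hg0 : ∀ p x, 0 ≤ ∏ q, if q ≤ p then (1 : ℝ) else max 0 (ε - (y x).1 q) := fun p x =>
    Finset.prod_nonneg fun q _ => by split_ifs <;> simp
  have hgx : ∀ p x, g p x ≠ 0 → x.1 p ≠ 0 := fun p x h => left_ne_zero_of_mul h
  obtain ⟨z, hz⟩ := exists_orderSimplex_map g
    (fun p => by
      refine (hcoord (ContinuousMap.id _) p).mul (continuous_finsetProd _ fun q _ => ?_)
      split_ifs
      · exact continuous_const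
      · exact continuous_const.max (continuous_const.sub (hcoord y q)))
    (fun p x => mul_nonneg (stdSimplex.zero_le _ _) (hg0 p x))
    (fun x => by
      obtain ⟨p, hp, hmax⟩ := x.exists_max
      refine ⟨p, mul_ne_zero hp (Finset.prod_ne_zero_iff.2 fun q _ => ?_)⟩
      split_ifs with hq
      · exact one_ne_zero
      · have h0 : (y x).1 q = 0 := by
          by_contra hcon
          exact hq (hy x p hmax q hcon)
        rw [h0, sub_zero]
        exact (lt_max_of_lt_right hε).ne')
    (fun x => x.2.mono fun p hp => hgx p x hp)
  have hle : ∀ x p q, (z x).1 p ≠ 0 → (y' x).1 q ≠ 0 → q ≤ p := by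
    intro x p q hp hq
    by_contra hqp
    have h1 := Finset.prod_ne_zero_iff.1 (right_ne_zero_of_mul ((hz x p).1 hp)) q
      (Finset.mem_univ _)
    rw [if_neg hqp] at h1
    exact h1 (max_eq_left (by linarith [hy' x q hq]))
  refine (OrderSimplex.homotopic_of_isChain y' z fun x => ?_).trans
    (OrderSimplex.homotopic_of_isChain z _ fun x => ?_)
  · rintro p (hp | hp) q (hq | hq) hpq
    · exact (y' x).2 hp hq hpq
    · exact Or.inl (hle x q p hq hp)
    · exact Or.inr (hle x p q hp hq)
    · exact (z x).2 hp hq hpq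
  · refine x.2.mono ?_
    rintro p (hp | hp)
    · exact hgx p x ((hz x p).1 hp)
    · exact hp

open Topology in
theorem exists_map_orderSimplex_of_stratification {P : Type} [PartialOrder P] [Fintype P]
    {M : Type*} [PseudoMetricSpace M] (st : M → P) (hst : ∀ m, ∀ᶠ m' in 𝓝 m, st m ≤ st m')
    (hsurj : Function.Surjective st) :
    ∃ y : C(M, OrderSimplex P), ∀ m p, (y m).1 p ≠ 0 → p ≤ st m := by
  classical
  let d : P → M → ℝ := fun p m => Metric.infDist m (st ⁻¹' {p})
  have hdc : ∀ p, Continuous (d p) := fun p => Metric.continuous_infDist_pt _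
  have hd0 : ∀ m, d (st m) m = 0 := fun m => Metric.infDist_zero_of_mem rfl
  have hdpos : ∀ m p, ¬ st m ≤ p → 0 < d p m := by
    intro m p h
    refine (Metric.infDist_pos_iff_notMem_closure
      ((Set.singleton_nonempty p).preimage hsurj)).1 fun hm => ?_
    obtain ⟨m', hm', h'⟩ := (mem_closure_iff_frequently.1 hm).and_eventually (hst m) |>.exists
    rw [Set.mem_preimage, Set.mem_singleton_iff] at hm'
    exact h (hm' ▸ h')
  let w : P → P → M → ℝ := fun p q m =>
    if p ≤ q then 1 else if q ≤ p then d q m else max 0 (d q m - d p m)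
  have hw0 : ∀ p q m, 0 ≤ w p q m := by
    intro p q m
    simp only [w]
    split_ifs
    exacts [zero_le_one, Metric.infDist_nonneg, le_max_left _ _]
  have hw : ∀ p m, ∏ q, w p q m ≠ 0 → ∀ q, w p q m ≠ 0 := fun p m h q =>
    Finset.prod_ne_zero_iff.1 h q (Finset.mem_univ _)
  obtain ⟨y, hy⟩ := exists_orderSimplex_map (fun p m => ∏ q, w p q m)
    (fun p => by
      refine continuous_finsetProd _ fun q _ => ?_
      simp only [w]
      split_ifs
      exacts [continuous_const, hdc q, continuous_const.max ((hdc q).sub (hdc p))])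
    (fun p m => Finset.prod_nonneg fun q _ => hw0 p q m)
    (fun m => by
      refine ⟨st m, Finset.prod_ne_zero_iff.2 fun q _ => ?_⟩
      simp only [w]
      split_ifs with h1 h2
      · exact one_ne_zero
      · exact (hdpos m q h1).ne'
      · rw [hd0, sub_zero]
        exact (lt_max_of_lt_right (hdpos m q h1)).ne')
    (fun m p hp q hq _ => by
      by_contra! hcon
      have h1 := hw p m hp q
      have h2 := hw q m hq p
      simp only [w, if_neg hcon.1, if_neg hcon.2] at h1 h2
      rcases le_total (d q m) (d p m) with h | h
      · exact h1 (max_eq_left (by linarith))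
      · exact h2 (max_eq_left (by linarith)))
  refine ⟨y, fun m p hp => ?_⟩
  by_contra hcon
  have h1 := hw p m ((hy m p).1 hp) (st m)
  simp only [w, if_neg hcon, hd0] at h1
  split_ifs at h1 with h2
  · exact h1 rfl
  · exact h1 (max_eq_left (by linarith [Metric.infDist_nonneg (x := m) (s := st ⁻¹' {p})]))

open Topology in
theorem nonempty_homotopyEquiv_of_stratification_s2 {P : Type} [PartialOrder P] [Fintype P]
    {W : Type*} [NormedAddCommGroup W] [NormedSpace ℝ W] {M : Set W} (st : M → P) (pt : P → W)
    (hst : ∀ m, ∀ᶠ m' in 𝓝 m, st m ≤ st m') (hsurj : Function.Surjective st)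
    (hmem : ∀ x : OrderSimplex P, ∃ h : ∑ p, x.1 p • pt p ∈ M,
      ∀ q, (∀ p, x.1 p ≠ 0 → p ≤ q) → st ⟨_, h⟩ ≤ q)
    (hseg : ∀ (m : M) (x : OrderSimplex P), (∀ p, x.1 p ≠ 0 → p ≤ st m) →
      segment ℝ (m : W) (∑ p, x.1 p • pt p) ⊆ M) :
    Nonempty (ContinuousMap.HomotopyEquiv (OrderSimplex P) M) := by
  obtain ⟨y, hy⟩ := exists_map_orderSimplex_of_stratification st hst hsurj
  obtain ⟨ε, hε, y', hy'⟩ := OrderSimplex.exists_truncation y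
  have hcont : Continuous fun x : OrderSimplex P => ∑ p, x.1 p • pt p :=
    continuous_finsetSum _ fun p _ => ((continuous_apply p).comp
      (continuous_subtype_val.comp continuous_subtype_val)).smul continuous_const
  let φ : C(OrderSimplex P, M) := ⟨fun x => ⟨_, (hmem x).1⟩, hcont.subtype_mk _⟩
  refine ⟨⟨φ, y', ?_, ?_⟩⟩
  · exact OrderSimplex.homotopic_id_of_truncation (y.comp φ) (y'.comp φ) hε
      (fun x p hp => hy' _ p hp) fun x p hp q hq => (hy _ q hq).trans ((hmem x).2 p hp)
  · refine ContinuousMap.Homotopic.symm ⟨⟨⟨fun a => ⟨(1 - (a.1 : ℝ)) • (a.2 : W) +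
      (a.1 : ℝ) • ∑ p, (y' a.2).1 p • pt p, hseg a.2 (y' a.2) (fun p hp => hy _ p
        (hε.trans (hy' _ p hp)).ne') ⟨1 - (a.1 : ℝ), a.1, by linarith [a.1.2.2], a.1.2.1,
          by ring, rfl⟩⟩, ?_⟩, ?_, ?_⟩⟩
    · refine Continuous.subtype_mk ?_ _
      have h1 : Continuous fun a : unitInterval × M => (a.1 : ℝ) :=
        continuous_subtype_val.comp continuous_fst
      exact ((continuous_const.sub h1).smul (continuous_subtype_val.comp continuous_snd)).add
        (h1.smul (hcont.comp (y'.continuous.comp continuous_snd)))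
    · intro m
      apply Subtype.ext
      simp
    · intro m
      apply Subtype.ext
      simp [φ]

theorem sign_eq_iff_mul_pos {c : SignType} (hc : c ≠ 0) (a : ℝ) :
    SignType.sign a = c ↔ 0 < (c : ℝ) * a := by
  cases c
  · exact absurd rfl hc
  · simp [sign_eq_neg_one_iff]
  · simp [sign_eq_one_iff]

theorem eventually_sign_eq {X : Type*} [TopologicalSpace X] {g : X → ℝ} {x : X}
    (hg : ContinuousAt g x) (h : g x ≠ 0) :
    ∀ᶠ y in nhds x, SignType.sign (g y) = SignType.sign (g x) := by
  have := ContinuousAt.comp (continuousAt_sign_of_ne_zero h) hg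
  exact this.eventually_mem (isOpen_discrete {SignType.sign (g x)} |>.mem_nhds rfl)

theorem exists_perturbation {V E : Type*} [NormedAddCommGroup V] [NormedSpace ℝ V]
    [Finite E] (f : E → (V →ᵃ[ℝ] ℝ)) {K : Set V} (hK : IsOpen K) {v : V} (hv : v ∈ K) (w : V) :
    ∃ u ∈ K, ∀ e, SignType.sign (f e u) =
      if f e v = 0 then SignType.sign ((f e).linear w) else SignType.sign (f e v) := by
  have hline : ∀ e (t : ℝ), f e (v + t • w) = f e v + t * (f e).linear w := fun e t => by
    rw [add_comm v, ← vadd_eq_add, AffineMap.map_vadd]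
    simp [add_comm]
  have hcont : Continuous fun t : ℝ => v + t • w := by fun_prop
  have hmem : ∀ᶠ t : ℝ in nhds 0, v + t • w ∈ K :=
    hcont.continuousAt.eventually_mem (hK.mem_nhds (by simpa using hv))
  have hsign : ∀ᶠ t : ℝ in nhds 0, ∀ e, f e v ≠ 0 →
      SignType.sign (f e (v + t • w)) = SignType.sign (f e v) := by
    refine Filter.eventually_all.2 fun e => ?_
    by_cases he : f e v = 0
    · simp [he]
    have := eventually_sign_eq (g := fun t : ℝ => f e v + t * (f e).linear w) (x := 0)
      (by fun_prop) (by simpa using he)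
    filter_upwards [this] with t ht _
    rw [hline, ht]
    simp
  obtain ⟨t, ⟨h1, h2⟩, ht⟩ := (((hmem.and hsign).filter_mono nhdsWithin_le_nhds).and
    (self_mem_nhdsWithin : Set.Ioi (0 : ℝ) ∈ nhdsWithin 0 (Set.Ioi 0))).exists
  refine ⟨_, h1, fun e => ?_⟩
  split_ifs with he
  · rw [hline, he, zero_add, sign_mul, sign_pos ht, one_mul]
  · exact h2 e he

theorem isTope_of_forall_ne_zero {V E : Type*} [NormedAddCommGroup V] [NormedSpace ℝ V]
    {f : E → (V →ᵃ[ℝ] ℝ)} {K : Set V} {T : E → SignType} (hT : T ∈ covs f K)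
    (h : ∀ e, T e ≠ 0) : IsTope f K T := by
  refine ⟨hT, fun Y _ hle => ?_⟩
  rw [← hle]
  funext e
  simp [scomp, h e]

theorem IsTope.apply_ne_zero {V E : Type*} [NormedAddCommGroup V] [NormedSpace ℝ V]
    [Finite E] {f : E → (V →ᵃ[ℝ] ℝ)} (hf : ∀ e, (f e).linear ≠ 0) {K : Set V} (hK : IsOpen K)
    {T : E → SignType} (hT : IsTope f K T) (e : E) : T e ≠ 0 := by
  obtain ⟨v, hv, hvK⟩ := hT.1
  obtain ⟨w, hw⟩ := Module.Dual.exists_forall_ne_zero_of_forall_exists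
    (fun e => (f e).linear) fun e => by
      by_contra! h
      exact hf e (LinearMap.ext h)
  obtain ⟨u, huK, hu⟩ := exists_perturbation f hK hvK w
  have hY := hT.2 (fun e => SignType.sign (f e u)) ⟨u, fun _ => rfl, huK⟩ (by
    funext e
    change (if T e = 0 then _ else T e) = _
    split_ifs with h
    · rfl
    · rw [← hv e, sign_eq_zero_iff] at h
      rw [hu, if_neg h, hv])
  intro h0
  have h1 := congrFun hY e
  have h2 : f e v = 0 := by rw [← sign_eq_zero_iff, hv, h0]
  simp only [h0, hu, if_pos h2, sign_eq_zero_iff] at h1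
  exact hw e h1

/-- The complexified complement as a subset of `V × V`. -/
def complementSet {V E : Type*} [NormedAddCommGroup V] [NormedSpace ℝ V]
    (f : E → (V →ᵃ[ℝ] ℝ)) (K : Set V) : Set (V × V) :=
  {p | p.1 ∈ K ∧ ∀ e, ¬(f e p.1 = 0 ∧ (f e).linear p.2 = 0)}

theorem exists_stratum {V E : Type*} [NormedAddCommGroup V] [NormedSpace ℝ V]
    [Finite E] (f : E → (V →ᵃ[ℝ] ℝ)) {K : Set V} (hK : IsOpen K) (m : complementSet f K) :
    ∃ p : SalP f K, ∀ e, p.X e = SignType.sign (f e m.1.1) ∧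
      p.T e = if f e m.1.1 = 0 then SignType.sign ((f e).linear m.1.2)
        else SignType.sign (f e m.1.1) := by
  obtain ⟨u, huK, hu⟩ := exists_perturbation f hK m.2.1 m.1.2
  refine ⟨⟨fun e => SignType.sign (f e m.1.1), fun e => SignType.sign (f e u),
    ⟨m.1.1, fun _ => rfl, m.2.1⟩,
    isTope_of_forall_ne_zero ⟨u, fun _ => rfl, huK⟩ fun e => ?_, ?_⟩, fun e => ⟨rfl, hu e⟩⟩
  · rw [hu]
    split_ifs with h
    · exact fun h' => m.2.2 e ⟨h, sign_eq_zero_iff.1 h'⟩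
    · exact fun h' => h (sign_eq_zero_iff.1 h')
  · funext e
    change (if SignType.sign (f e m.1.1) = 0 then SignType.sign (f e u)
      else SignType.sign (f e m.1.1)) = SignType.sign (f e u)
    split_ifs with h
    · rfl
    · rw [hu e, if_neg fun h' => h (sign_eq_zero_iff.2 h')]

theorem SalP.exists_point {V E : Type*} [NormedAddCommGroup V] [NormedSpace ℝ V]
    [Finite E] {f : E → (V →ᵃ[ℝ] ℝ)} (hf : ∀ e, (f e).linear ≠ 0) {K : Set V} (hK : IsOpen K)
    (p : SalP f K) : ∃ m : complementSet f K, ∀ e, p.X e = SignType.sign (f e m.1.1) ∧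
      p.T e = if f e m.1.1 = 0 then SignType.sign ((f e).linear m.1.2)
        else SignType.sign (f e m.1.1) := by
  obtain ⟨v, hv, hvK⟩ := p.memX
  obtain ⟨u, hu, -⟩ := p.topeT.1
  have hlin : ∀ e, (f e).linear (u - v) = f e u - f e v := fun e => by
    rw [← vsub_eq_sub, AffineMap.linearMap_vsub, vsub_eq_sub]
  refine ⟨⟨(v, u - v), hvK, fun e h => ?_⟩, fun e => ⟨(hv e).symm, ?_⟩⟩
  · refine p.topeT.apply_ne_zero hf hK e ?_
    rw [← hu, sign_eq_zero_iff]
    have := h.2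
    rw [hlin, h.1, sub_zero] at this
    exact this
  · change _ = if f e v = 0 then SignType.sign ((f e).linear (u - v)) else SignType.sign (f e v)
    split_ifs with h
    · rw [hlin, h, sub_zero, hu]
    · have h1 := congrFun p.leXT e
      have h2 : p.X e ≠ 0 := by rwa [← hv, Ne, sign_eq_zero_iff]
      rw [hv, ← h1]
      simp [scomp, h2]

/-- The points of `V × V` satisfying the sign conditions common to all strata below `(X, T)`. -/
def stratumCone {V E : Type*} [NormedAddCommGroup V] [NormedSpace ℝ V]
    (f : E → (V →ᵃ[ℝ] ℝ)) (K : Set V) (X T : E → SignType) : Set (V × V) :=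
  {m | m.1 ∈ K ∧ ∀ e, 0 ≤ (X e : ℝ) * f e m.1 ∧
    (X e = 0 → f e m.1 = 0 ∧ 0 < (T e : ℝ) * (f e).linear m.2)}

theorem convex_stratumCone {V E : Type*} [NormedAddCommGroup V] [NormedSpace ℝ V]
    (f : E → (V →ᵃ[ℝ] ℝ)) {K : Set V} (hK : Convex ℝ K) (X T : E → SignType) :
    Convex ℝ (stratumCone f K X T) := by
  intro x hx y hy a b ha hb hab
  refine ⟨hK hx.1 hy.1 ha hb hab, fun e => ?_⟩
  have h1 : f e (a • x + b • y).1 = a * f e x.1 + b * f e y.1 :=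
    Convex.combo_affine_apply hab
  have h2 : (f e).linear (a • x + b • y).2 = a * (f e).linear x.2 + b * (f e).linear y.2 := by
    simp
  obtain ⟨hx1, hx2⟩ := hx.2 e
  obtain ⟨hy1, hy2⟩ := hy.2 e
  refine ⟨?_, fun h => ⟨?_, ?_⟩⟩
  · rw [h1]
    nlinarith [mul_nonneg ha hx1, mul_nonneg hb hy1]
  · rw [h1, (hx2 h).1, (hy2 h).1]
    ring
  · rw [h2]
    have hp := convex_Ioi (𝕜 := ℝ) (0 : ℝ) (hx2 h).2 (hy2 h).2 ha hb hab
    simp only [smul_eq_mul, Set.mem_Ioi] at hp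
    linarith

theorem mem_stratumCone_of_le {V E : Type*} [NormedAddCommGroup V] [NormedSpace ℝ V]
    [Finite E] {f : E → (V →ᵃ[ℝ] ℝ)} (hf : ∀ e, (f e).linear ≠ 0) {K : Set V} (hK : IsOpen K)
    (m : complementSet f K) (p q : SalP f K) (hpq : p ≤ q)
    (hm : ∀ e, p.X e = SignType.sign (f e m.1.1) ∧
      p.T e = if f e m.1.1 = 0 then SignType.sign ((f e).linear m.1.2)
        else SignType.sign (f e m.1.1)) :
    (m : V × V) ∈ stratumCone f K q.X q.T := by
  refine ⟨m.2.1, fun e => ?_⟩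
  obtain ⟨hX, hT⟩ := hm e
  have h1 : (if p.X e = 0 then q.X e else p.X e) = q.X e := congrFun hpq.1 e
  have h2 : (if q.X e = 0 then p.T e else q.X e) = q.T e := congrFun hpq.2 e
  constructor
  · split_ifs at h1 with h
    · rw [h, eq_comm, sign_eq_zero_iff] at hX
      simp [hX]
    · rw [← h1]
      exact ((sign_eq_iff_mul_pos h _).1 hX.symm).le
  · intro hq
    have hp : p.X e = 0 := by
      by_contra hp
      rw [if_neg hp, hq] at h1
      exact hp h1
    have h0 : f e m.1.1 = 0 := by rwa [hX, sign_eq_zero_iff] at hp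
    rw [if_pos h0] at hT
    rw [if_pos hq, hT] at h2
    exact ⟨h0, (sign_eq_iff_mul_pos (q.topeT.apply_ne_zero hf hK e) _).1 h2⟩

theorem mem_complementSet_of_stratumCone {V E : Type*} [NormedAddCommGroup V] [NormedSpace ℝ V]
    {f : E → (V →ᵃ[ℝ] ℝ)} {K : Set V} {X T : E → SignType} {m : V × V}
    (hm : m ∈ stratumCone f K X T) (h : ∀ e, X e ≠ 0 → f e m.1 ≠ 0) : m ∈ complementSet f K := by
  refine ⟨hm.1, fun e he => ?_⟩
  by_cases hX : X e = 0
  · have := ((hm.2 e).2 hX).2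
    simp [he.2] at this
  · exact h e hX he.1

theorem le_of_mem_stratumCone {V E : Type*} [NormedAddCommGroup V] [NormedSpace ℝ V]
    [Finite E] {f : E → (V →ᵃ[ℝ] ℝ)} (hf : ∀ e, (f e).linear ≠ 0) {K : Set V} (hK : IsOpen K)
    {m : V × V} {p q : SalP f K}
    (hm : ∀ e, p.X e = SignType.sign (f e m.1) ∧
      p.T e = if f e m.1 = 0 then SignType.sign ((f e).linear m.2)
        else SignType.sign (f e m.1))
    (hmq : m ∈ stratumCone f K q.X q.T) : p ≤ q := by
  refine ⟨funext fun e => ?_, funext fun e => ?_⟩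
  · change (if p.X e = 0 then q.X e else p.X e) = q.X e
    split_ifs with h
    · rfl
    · by_cases hq : q.X e = 0
      · rw [(hm e).1, ((hmq.2 e).2 hq).1, hq, sign_zero]
      · rw [(hm e).1, sign_eq_iff_mul_pos hq]
        rw [(hm e).1, sign_eq_zero_iff] at h
        refine (hmq.2 e).1.lt_of_ne' (mul_ne_zero ?_ h)
        revert hq
        cases q.X e <;> simp
  · change (if q.X e = 0 then p.T e else q.X e) = q.T e
    split_ifs with h
    · obtain ⟨h1, h2⟩ := (hmq.2 e).2 h
      rw [(hm e).2, if_pos h1, sign_eq_iff_mul_pos (q.topeT.apply_ne_zero hf hK e)]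
      exact h2
    · have := congrFun q.leXT e
      rw [← this]
      simp [scomp, h]

theorem eventually_stratum_le {V E : Type*} [NormedAddCommGroup V] [NormedSpace ℝ V]
    [FiniteDimensional ℝ V] [Finite E] {f : E → (V →ᵃ[ℝ] ℝ)} {K : Set V}
    (st : complementSet f K → SalP f K)
    (hst : ∀ m e, (st m).X e = SignType.sign (f e m.1.1) ∧
      (st m).T e = if f e m.1.1 = 0 then SignType.sign ((f e).linear m.1.2)
        else SignType.sign (f e m.1.1)) (m : complementSet f K) :
    ∀ᶠ m' in nhds m, st m ≤ st m' := by
  have hc : ∀ e, Continuous fun m : complementSet f K => f e m.1.1 := fun e =>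
    (f e).continuous_of_finiteDimensional.comp (continuous_fst.comp continuous_subtype_val)
  have hl : ∀ e, Continuous fun m : complementSet f K => (f e).linear m.1.2 := fun e =>
    (f e).linear.continuous_of_finiteDimensional.comp (continuous_snd.comp continuous_subtype_val)
  have key : ∀ᶠ m' in nhds m, ∀ e,
      (if (st m).X e = 0 then (st m').X e else (st m).X e) = (st m').X e ∧
      (if (st m').X e = 0 then (st m).T e else (st m').X e) = (st m').T e := by
    refine Filter.eventually_all.2 fun e => ?_
    by_cases he : f e m.1.1 = 0
    · have hle : (f e).linear m.1.2 ≠ 0 := fun h => m.2.2 e ⟨he, h⟩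
      filter_upwards [eventually_sign_eq (hl e).continuousAt hle] with m' hm'
      simp only [(hst _ e).1, (hst _ e).2, he, sign_eq_zero_iff]
      split_ifs <;> simp_all
    · filter_upwards [eventually_sign_eq (hc e).continuousAt he] with m' hm'
      have he' : f e m'.1.1 ≠ 0 := fun h =>
        he (by rw [← sign_eq_zero_iff, ← hm', h, sign_zero])
      simp only [(hst _ e).1, (hst _ e).2, sign_eq_zero_iff, if_neg he, if_neg he', hm', and_self]
  filter_upwards [key] with m' hm'
  exact ⟨funext fun e => (hm' e).1, funext fun e => (hm' e).2⟩

theorem Convex.stdSimplex_sum_mem {ι W : Type*} [Fintype ι] [AddCommGroup W] [Module ℝ W] {s : Set W}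
    (hs : Convex ℝ s) (x : stdSimplex ℝ ι) (z : ι → W) (hz : ∀ i, x i ≠ 0 → z i ∈ s) :
    ∑ i, x i • z i ∈ s := by
  classical
  rw [← Finset.sum_filter_of_ne (p := fun i => x i ≠ 0)
    fun i _ h h0 => h (by rw [h0, zero_smul])]
  refine hs.sum_mem (fun i _ => stdSimplex.zero_le x i) ?_ fun i hi => hz i (by simpa using hi)
  rw [Finset.sum_filter_ne_zero]
  exact stdSimplex.sum_eq_one x

theorem AffineMap.map_stdSimplex_sum_smul {ι V : Type*} [Fintype ι] [AddCommGroup V] [Module ℝ V]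
    (f : V →ᵃ[ℝ] ℝ) (x : stdSimplex ℝ ι) (z : ι → V) :
    f (∑ i, x i • z i) = ∑ i, x i * f (z i) := by
  have h : ∀ v, f v = f.linear v + f 0 := fun v => congrFun f.decomp v
  rw [h, map_sum]
  simp_rw [h (z _), mul_add, Finset.sum_add_distrib, ← Finset.sum_mul]
  rw [stdSimplex.sum_eq_one x, one_mul]
  simp

/-- For any nonempty convex open subset `K ⊆ V`, the Salvetti complex `|Sal(A,K)|` is
homotopy equivalent to the manifold `M(A,K)`. -/
theorem salvetti_complex_homotopy_equiv_complement_pair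
    (f : E → (V →ᵃ[ℝ] ℝ)) (hf : ∀ e, (f e).linear ≠ 0)
    (K : Set V) (hKne : K.Nonempty) (hKconv : Convex ℝ K) (hKopen : IsOpen K) :
    Nonempty (ContinuousMap.HomotopyEquiv ↥(orderComplex (SalP f K)) (MSpace f K)) := by
  classical
  have : Finite (SalP f K) := Finite.of_injective (fun p => (p.X, p.T)) fun p q h => by
    simp only [Prod.mk.injEq] at h
    exact SalP.ext h.1 h.2
  have := Fintype.ofFinite (SalP f K)
  choose st hst using exists_stratum f hKopen
  choose pt hpt using SalP.exists_point hf hKopen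
  have hstpt : ∀ p, st (pt p) = p := fun p => SalP.ext
    (funext fun e => (hst _ e).1.trans (hpt p e).1.symm)
    (funext fun e => (hst _ e).2.trans (hpt p e).2.symm)
  have hcone : ∀ (x : OrderSimplex (SalP f K)) q, (∀ p, x.1 p ≠ 0 → p ≤ q) →
      ∑ p, x.1 p • (pt p : V × V) ∈ stratumCone f K q.X q.T := fun x q hq =>
    (convex_stratumCone f hKconv _ _).stdSimplex_sum_mem _ _ fun p hp =>
      mem_stratumCone_of_le hf hKopen (pt p) p q (hq p hp) (hpt p)
  have hmem : ∀ x : OrderSimplex (SalP f K),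
      ∑ p, x.1 p • (pt p : V × V) ∈ complementSet f K := by
    intro x
    obtain ⟨q, hxq, hq⟩ := x.exists_max
    refine mem_complementSet_of_stratumCone (hcone x q hq) fun e he h => ?_
    have h1 : f e (∑ p, x.1 p • (pt p : V × V)).1 = ∑ p, x.1 p * f e (pt p).1.1 := by
      rw [Prod.fst_sum]
      exact (f e).map_stdSimplex_sum_smul x.1 fun p => (pt p).1.1
    have h2 : 0 < ∑ p, (q.X e : ℝ) * (x.1 p * f e (pt p).1.1) := by
      refine Finset.sum_pos' (fun p _ => ?_) ⟨q, Finset.mem_univ _, ?_⟩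
      · by_cases hp : x.1 p = 0
        · simp [hp]
        · have := ((mem_stratumCone_of_le hf hKopen (pt p) p q (hq p hp) (hpt p)).2 e).1
          rw [mul_left_comm]
          exact mul_nonneg (stdSimplex.zero_le _ _) this
      · rw [mul_left_comm]
        exact mul_pos ((stdSimplex.zero_le _ _).lt_of_ne' hxq)
          ((sign_eq_iff_mul_pos he _).1 (hpt q e).1.symm)
    rw [← Finset.mul_sum, ← h1, h, mul_zero] at h2
    exact h2.false
  obtain ⟨h⟩ := nonempty_homotopyEquiv_of_stratification_s2 st (fun p => (pt p : V × V))
    (eventually_stratum_le st hst) (fun p => ⟨pt p, hstpt p⟩)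
    (fun x => ⟨hmem x, fun q hq => le_of_mem_stratumCone hf hKopen (hst _) (hcone x q hq)⟩)
    (fun m x hx => by
      have hm := mem_stratumCone_of_le hf hKopen m (st m) (st m) le_rfl (hst m)
      have hx' := hcone x (st m) hx
      rintro _ ⟨a, b, ha, hb, hab, rfl⟩
      rcases ha.eq_or_lt with rfl | ha
      · obtain rfl : b = 1 := by linarith
        simpa using hmem x
      refine mem_complementSet_of_stratumCone
        (convex_stratumCone f hKconv _ _ hm hx' ha.le hb hab) fun e he h => ?_
      have h1 : f e (a • (m : V × V) + b • ∑ p, x.1 p • (pt p : V × V)).1 =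
          a * f e m.1.1 + b * f e (∑ p, x.1 p • (pt p : V × V)).1 :=
        Convex.combo_affine_apply hab
      rw [h1] at h
      have h2 := (sign_eq_iff_mul_pos he _).1 (hst m e).1.symm
      have h3 := mul_pos ha h2
      have h4 := mul_nonneg hb (hx'.2 e).1
      have h5 : ((st m).X e : ℝ) * (a * f e m.1.1 +
          b * f e (∑ p, x.1 p • (pt p : V × V)).1) = 0 := by rw [h, mul_zero]
      nlinarith)
  exact ⟨(realizationHomeomorph (SalP f K)).toHomotopyEquiv.trans h⟩
end
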